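/- Let α > 0 and 4 < p < ∞. There exists a point γ_{−1} ∈ ℂ∖Γ with |γ_{−1}| ≤ |γ_0| such that Γ ∪ {γ_{−1}} is a complete interpolating sequence for F^p_φ if and only if the following three conditions hold: (a) Γ is d_ρ-separated; (b) the sequence (δ_n)_{n≥0} is bounded; (c) there exists an integer N ≥ 1 such that 1/(pα) − 1/(4α) < ∇_N ≤ Δ_N < 1/(pα) + 1/(4α). -/

import Mathlib

open MeasureTheory Complex
open scoped ENNReal

noncomputable section

/-- `log⁺ t = max (log t) 0`. -/
def logPlus (t : ℝ) : ℝ := max (Real.log t) 0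

/-- The weight `φ(z) = α (log⁺ |z|)²`. -/
def phi (α : ℝ) (z : ℂ) : ℝ := α * (logPlus (‖z‖)) ^ 2

/-- `‖f‖_{p,φ}^p = ∫_ℂ |f(z) e^{-φ(z)}|^p dm(z)` as an extended nonnegative real. -/
def fockNormP (α p : ℝ) (f : ℂ → ℂ) : ℝ≥0∞ :=
  ∫⁻ z : ℂ, ENNReal.ofReal ((‖f z‖ * Real.exp (-(phi α z))) ^ p)

/-- Membership in the Fock space `F^p_φ`: entire and finite norm. -/
def MemFock (α p : ℝ) (f : ℂ → ℂ) : Prop :=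
  Differentiable ℂ f ∧ fockNormP α p f < ⊤

/-- The discrete norm `‖f‖_{p,φ,Λ}^p = Σ_{λ∈Λ} (1+|λ|)² |f(λ)|^p e^{-pφ(λ)}`. -/
def discNormP (α p : ℝ) (Λ : Set ℂ) (f : ℂ → ℂ) : ℝ≥0∞ :=
  ∑' lam : Λ, ENNReal.ofReal
    ((1 + ‖(lam : ℂ)‖) ^ 2 * ‖f (lam : ℂ)‖ ^ p *
      Real.exp (-(p * phi α (lam : ℂ))))

/-- `Λ` is sampling for `F^p_φ`. -/
def Sampling (α p : ℝ) (Λ : Set ℂ) : Prop :=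
  ∃ C : ℝ, 1 ≤ C ∧ ∀ f : ℂ → ℂ, MemFock α p f →
    (ENNReal.ofReal C)⁻¹ * fockNormP α p f ≤ discNormP α p Λ f ∧
    discNormP α p Λ f ≤ ENNReal.ofReal C * fockNormP α p f

/-- `Λ` is interpolating for `F^p_φ`. -/
def Interpolating (α p : ℝ) (Λ : Set ℂ) : Prop :=
  ∀ v : ℂ → ℂ,
    (∑' lam : Λ, ENNReal.ofReal
      ((1 + ‖(lam : ℂ)‖) ^ 2 * ‖v (lam : ℂ)‖ ^ p *
        Real.exp (-(p * phi α (lam : ℂ))))) < ⊤ →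
    ∃ f : ℂ → ℂ, MemFock α p f ∧ ∀ lam ∈ Λ, f lam = v lam

/-- `Λ` is a complete interpolating sequence for `F^p_φ`. -/
def CompleteInterpolating (α p : ℝ) (Λ : Set ℂ) : Prop :=
  Sampling α p Λ ∧ Interpolating α p Λ

/-- `ρ(z) = |z| / √(2α)`. -/
def rhoF (α : ℝ) (z : ℂ) : ℝ := ‖z‖ / Real.sqrt (2 * α)

/-- `d_ρ(z,w) = |z-w| / (1 + min(ρ(z), ρ(w)))`. -/
def dRho (α : ℝ) (z w : ℂ) : ℝ :=
  ‖z - w‖ / (1 + min (rhoF α z) (rhoF α w))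

/-- `Λ` is `d_ρ`-separated. -/
def DRhoSeparated (α : ℝ) (Λ : Set ℂ) : Prop :=
  ∃ ε : ℝ, 0 < ε ∧ ∀ l ∈ Λ, ∀ l' ∈ Λ, l ≠ l' → ε ≤ dRho α l l'

/-- The average `(1/N) Σ_{k=n}^{n+N-1} δ_k`. -/
def avgD (δ : ℕ → ℝ) (N n : ℕ) : ℝ := (1 / (N : ℝ)) * ∑ k ∈ Finset.range N, δ (n + k)

/-! ### Schur test and weights -/

lemma jensen_tsum {p : ℝ} (hp : 1 < p) (K b : ℕ → ℝ≥0∞) :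
    (∑' k, K k * b k) ^ p ≤ (∑' k, K k) ^ (p - 1) * ∑' k, K k * b k ^ p := by
  have hp0 : 0 < p := by linarith
  have hpq : (Real.conjExponent p).HolderConjugate p := (Real.HolderConjugate.conjExponent hp).symm
  set q := Real.conjExponent p with hq
  have hq0 : 0 < q := hpq.pos
  have h1 : 1 / q + 1 / p = 1 := by
    have := hpq.inv_add_inv_eq_one
    simpa using this
  have H := ENNReal.lintegral_mul_le_Lp_mul_Lq (Measure.count : Measure ℕ) hpq
    (f := fun k => K k ^ (1 / q)) (g := fun k => K k ^ (1 / p) * b k)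
    (measurable_of_countable _).aemeasurable (measurable_of_countable _).aemeasurable
  simp only [lintegral_count, Pi.mul_apply] at H
  have e1 : ∀ k, K k ^ (1 / q) * (K k ^ (1 / p) * b k) = K k * b k := by
    intro k
    rw [← mul_assoc, ← ENNReal.rpow_add_of_nonneg _ _ (by positivity) (by positivity), h1,
      ENNReal.rpow_one]
  have e2 : ∀ k, (K k ^ (1 / q)) ^ q = K k := by
    intro k
    rw [← ENNReal.rpow_mul, one_div_mul_cancel hq0.ne', ENNReal.rpow_one]
  have e3 : ∀ k, (K k ^ (1 / p) * b k) ^ p = K k * b k ^ p := by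
    intro k
    rw [ENNReal.mul_rpow_of_nonneg _ _ hp0.le, ← ENNReal.rpow_mul, one_div_mul_cancel hp0.ne',
      ENNReal.rpow_one]
  simp only [e1, e2, e3] at H
  have H2 := ENNReal.rpow_le_rpow H hp0.le
  rw [ENNReal.mul_rpow_of_nonneg _ _ hp0.le, ← ENNReal.rpow_mul, ← ENNReal.rpow_mul,
    one_div_mul_cancel hp0.ne', ENNReal.rpow_one] at H2
  have e4 : 1 / q * p = p - 1 := by
    have : 1 / q = 1 - 1 / p := by linarith
    rw [this]; field_simp
  rwa [e4] at H2

/-- The exponential kernel. -/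
def Kr (κ : ℝ) (j k : ℕ) : ℝ≥0∞ := ENNReal.ofReal (Real.exp (-(κ * |(j : ℝ) - k|)))

lemma Kr_symm (κ : ℝ) (j k : ℕ) : Kr κ j k = Kr κ k j := by
  unfold Kr; rw [abs_sub_comm]

lemma Kr_sum {κ : ℝ} (hκ : 0 < κ) : ∃ C : ℝ, 0 < C ∧ ∀ j, ∑' k, Kr κ j k ≤ ENNReal.ofReal C := by
  have hs : Summable (fun i : ℤ => Real.exp (-(κ * |(i : ℝ)|))) := by
    have hg : Summable (fun n : ℕ => Real.exp (-(κ * n))) := by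
      have : Summable (fun n : ℕ => (Real.exp (-κ)) ^ n) :=
        summable_geometric_of_lt_one (Real.exp_pos _).le (by simpa using hκ)
      refine this.congr fun n => ?_
      rw [← Real.exp_nat_mul]; congr 1; ring
    apply Summable.of_nat_of_neg
    · refine hg.congr fun n => ?_
      simp
    · refine hg.congr fun n => ?_
      simp
  refine ⟨(∑' i : ℤ, Real.exp (-(κ * |(i : ℝ)|))) + 1, ?_, fun j => ?_⟩
  · have : 0 ≤ ∑' i : ℤ, Real.exp (-(κ * |(i : ℝ)|)) := tsum_nonneg fun _ => (Real.exp_pos _).le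
    linarith
  have hinj : Function.Injective (fun k : ℕ => (j : ℤ) - k) := by
    intro k l h; simp only at h; omega
  have := ENNReal.tsum_comp_le_tsum_of_injective hinj
    (fun i : ℤ => ENNReal.ofReal (Real.exp (-(κ * |(i : ℝ)|))))
  rw [← ENNReal.ofReal_tsum_of_nonneg (fun _ => (Real.exp_pos _).le) hs] at this
  refine le_trans (le_of_eq ?_) (this.trans (ENNReal.ofReal_le_ofReal (by linarith)))
  refine tsum_congr fun k => ?_
  simp [Kr]

lemma schur {κ p : ℝ} (hκ : 0 < κ) (hp : 1 < p) : ∃ C : ℝ, 0 < C ∧ ∀ b : ℕ → ℝ≥0∞,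
    ∑' j, (∑' k, Kr κ j k * b k) ^ p ≤ ENNReal.ofReal C * ∑' k, b k ^ p := by
  obtain ⟨C, hC, hK⟩ := Kr_sum hκ
  refine ⟨C ^ (p - 1) * C, by positivity, fun b => ?_⟩
  calc ∑' j, (∑' k, Kr κ j k * b k) ^ p
      ≤ ∑' j, (ENNReal.ofReal C) ^ (p - 1) * ∑' k, Kr κ j k * b k ^ p := by
        refine ENNReal.tsum_le_tsum fun j => (jensen_tsum hp _ _).trans ?_
        gcongr
        exact hK j
    _ = (ENNReal.ofReal C) ^ (p - 1) * ∑' k, (∑' j, Kr κ k j) * b k ^ p := by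
        rw [ENNReal.tsum_mul_left, ENNReal.tsum_comm]
        congr 1
        refine tsum_congr fun k => ?_
        rw [← ENNReal.tsum_mul_right]
        refine tsum_congr fun j => ?_
        rw [Kr_symm]
    _ ≤ (ENNReal.ofReal C) ^ (p - 1) * ∑' k, ENNReal.ofReal C * b k ^ p := by
        gcongr with k
        exact hK k
    _ = _ := by
        rw [ENNReal.tsum_mul_left, ← mul_assoc, ENNReal.ofReal_rpow_of_pos hC,
          ← ENNReal.ofReal_mul (by positivity)]

/-- the weight at points -/
def Wt (α p : ℝ) (z : ℂ) : ℝ := Real.exp (-(phi α z)) * (1 + ‖z‖) ^ (2 / p)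

/-- the weight at coefficients -/
def wk (α p : ℝ) (k : ℕ) : ℝ := Real.exp (((k : ℝ) + 2 / p) ^ 2 / (4 * α))

lemma Wt_pos (α p : ℝ) (z : ℂ) : 0 < Wt α p z := by
  unfold Wt; positivity

lemma wk_pos (α p : ℝ) (k : ℕ) : 0 < wk α p k := Real.exp_pos _

lemma exp_logPlus {t : ℝ} (ht : 0 ≤ t) : Real.exp (logPlus t) = max 1 t := by
  unfold logPlus
  rcases ht.eq_or_lt with h | h
  · rw [← h]; simp
  · rcases le_total (Real.log t) 0 with h1 | h1
    · rw [max_eq_right h1, Real.exp_zero, max_eq_left]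
      exact (Real.log_nonpos_iff ht).1 h1
    · rw [max_eq_left h1, Real.exp_log h, max_eq_right]
      exact (Real.log_nonneg_iff h).1 h1

lemma Wt_lower {α p : ℝ} (hp : 0 < p) (z : ℂ) :
    Real.exp (-(α * logPlus ‖z‖ ^ 2) + 2 / p * logPlus ‖z‖) ≤ Wt α p z := by
  unfold Wt phi
  rw [Real.exp_add]
  gcongr
  rw [mul_comm (2 / p), Real.exp_mul, exp_logPlus (norm_nonneg _)]
  gcongr
  exact max_le (by linarith [norm_nonneg z]) (by linarith)

lemma Wt_upper {α p : ℝ} (hp : 0 < p) (z : ℂ) :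
    Wt α p z ≤ Real.exp (2 / p -(α * logPlus ‖z‖ ^ 2) + 2 / p * logPlus ‖z‖) := by
  unfold Wt phi
  have : 2 / p -(α * logPlus ‖z‖ ^ 2) + 2 / p * logPlus ‖z‖ =
    -(α * logPlus ‖z‖ ^ 2) + (1 + logPlus ‖z‖) * (2 / p) := by ring
  rw [this, Real.exp_add]
  gcongr
  rw [Real.exp_mul, Real.exp_add, exp_logPlus (norm_nonneg _)]
  gcongr
  have h2 : 2 ≤ Real.exp 1 := by have := Real.add_one_le_exp (1 : ℝ); linarith
  have h3 : 1 ≤ max 1 ‖z‖ := le_max_left _ _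
  have h4 : ‖z‖ ≤ max 1 ‖z‖ := le_max_right _ _
  nlinarith

lemma kernel_upper {α p : ℝ} (hα : 0 < α) (hp : 0 < p) (D : ℝ) : ∃ C : ℝ, 0 < C ∧
    ∀ (z : ℂ) (n k : ℕ), |logPlus ‖z‖ - n / (2 * α)| ≤ D →
      ‖z‖ ^ k * Wt α p z ≤ C * wk α p k * Real.exp (-|(n : ℝ) - k|) := by
  refine ⟨Real.exp (2 / p + (2 * α * D + 2 / p + α)), Real.exp_pos _, fun z n k h => ?_⟩
  set y := logPlus ‖z‖ with hy
  have h1 : ‖z‖ ^ k ≤ Real.exp (k * y) := by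
    rw [Real.exp_nat_mul]
    gcongr
    rw [exp_logPlus (norm_nonneg _)]; exact le_max_right _ _
  calc ‖z‖ ^ k * Wt α p z ≤ Real.exp (k * y) * Real.exp (2 / p -(α * y ^ 2) + 2 / p * y) := by
        exact mul_le_mul h1 (Wt_upper hp z) (Wt_pos α p z).le (Real.exp_pos _).le
    _ ≤ _ := by
        unfold wk
        rw [← Real.exp_add, ← Real.exp_add, ← Real.exp_add]
        apply Real.exp_le_exp.2
        set τ := 2 / p with hτ
        have hτ0 : 0 < τ := by positivity
        set t := y - (k + τ) / (2 * α) with ht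
        have e1 : (k : ℝ) * y + (τ - α * y ^ 2 + τ * y) =
            τ + (k + τ) ^ 2 / (4 * α) - α * t ^ 2 := by
          rw [ht]; field_simp; ring
        rw [e1]
        have e2 : |(n : ℝ) - k| ≤ 2 * α * D + 2 * α * |t| + τ := by
          have : (n : ℝ) - k = -(2 * α * (y - n / (2 * α))) + 2 * α * t + τ := by
            rw [ht]; field_simp; ring
          rw [this]
          have a1 := abs_add_le (-(2 * α * (y - n / (2 * α))) + 2 * α * t) τ
          have a2 := abs_add_le (-(2 * α * (y - n / (2 * α)))) (2 * α * t)
          rw [abs_neg, abs_mul (2 * α), abs_mul (2 * α), abs_of_pos (by positivity : 0 < 2 * α)] at a2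
          rw [abs_of_pos hτ0] at a1
          have := mul_le_mul_of_nonneg_left h (by positivity : 0 ≤ 2 * α)
          linarith
        have e3 : 2 * α * |t| - α ≤ α * t ^ 2 := by
          rw [← sq_abs t]; nlinarith [sq_nonneg (|t| - 1)]
        linarith

/-- lower kernel bound -/
lemma kernel_lower {α p : ℝ} (hα : 0 < α) (hp : 0 < p) (L : ℝ) : ∃ c : ℝ, 0 < c ∧
    ∀ (z : ℂ) (k : ℕ), z ≠ 0 → -L ≤ Real.log ‖z‖ →
      c * wk α p k * Real.exp (-(α * (Real.log ‖z‖ - (k + 2 / p) / (2 * α)) ^ 2))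
        ≤ ‖z‖ ^ k * Wt α p z := by
  refine ⟨1, one_pos, fun z k hz hL => ?_⟩
  have hz0 : 0 < ‖z‖ := norm_pos_iff.2 hz
  set y := Real.log ‖z‖ with hy
  have h1 : ‖z‖ ^ k = Real.exp (k * y) := by
    rw [Real.exp_nat_mul, hy, Real.exp_log hz0]
  have h2 : Real.exp (-(α * y ^ 2) + 2 / p * y) ≤ Wt α p z := by
    refine le_trans ?_ (Wt_lower hp z)
    apply Real.exp_le_exp.2
    unfold logPlus
    rw [← hy]
    rcases le_total y 0 with h | h
    · rw [max_eq_right h]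
      have : 2 / p * y ≤ 0 := mul_nonpos_of_nonneg_of_nonpos (by positivity) h
      have : 0 ≤ α * y ^ 2 := by positivity
      simp; linarith
    · rw [max_eq_left h]
  rw [h1]
  refine le_trans (le_of_eq ?_) (mul_le_mul_of_nonneg_left h2 (Real.exp_pos _).le)
  unfold wk
  rw [one_mul, ← Real.exp_add, ← Real.exp_add]
  congr 1
  field_simp
  ring

/-- log of the weight, for points not close to the origin -/
lemma log_Wt {α p : ℝ} (hα : 0 < α) (hp : 0 < p) (L : ℝ) : ∃ C : ℝ, 0 < C ∧
    ∀ (z : ℂ) (x : ℝ), ‖z‖ = Real.exp x → -L ≤ x →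
      |Real.log (Wt α p z) - (-(α * x ^ 2) + 2 / p * x)| ≤ C := by
  refine ⟨2 / p + α * L ^ 2 + 2 / p * |L|, by positivity, fun z x hz hL => ?_⟩
  have e1 := Real.le_log_iff_exp_le (Wt_pos α p z) |>.2 (Wt_lower hp z)
  have e2 := Real.log_le_iff_le_exp (Wt_pos α p z) |>.2 (Wt_upper hp z)
  have hy : logPlus ‖z‖ = max x 0 := by unfold logPlus; rw [hz, Real.log_exp]
  rw [hy] at e1 e2
  have hτ : 0 < 2 / p := by positivity
  have h3 : 0 ≤ α * L ^ 2 := by positivity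
  have h4 : 0 ≤ 2 / p * |L| := by positivity
  rw [abs_le]
  rcases le_total x 0 with h | h
  · rw [max_eq_right h] at e1 e2
    have hL' : 0 ≤ L := by linarith
    have h5 : x ^ 2 ≤ L ^ 2 := by nlinarith
    have h6 : α * x ^ 2 ≤ α * L ^ 2 := by gcongr
    have h7 : 2 / p * (-x) ≤ 2 / p * |L| := by
      rw [abs_of_nonneg hL']; gcongr; linarith
    have h8 : 0 ≤ α * x ^ 2 := by positivity
    have h9 : 0 ≤ 2 / p * (-x) := mul_nonneg hτ.le (by linarith)
    simp at e1 e2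
    constructor <;> linarith
  · rw [max_eq_left h] at e1 e2
    constructor <;> linarith

/-! ### Norm equivalence: Fock norm versus weighted `ℓ^p` norm of Taylor coefficients -/

/-- `c` is the sequence of Taylor coefficients of `f`. -/
def Coef (c : ℕ → ℂ) (f : ℂ → ℂ) : Prop := ∀ z, HasSum (fun k => c k * z ^ k) (f z)

/-- normalized coefficients -/
def bet (α p : ℝ) (c : ℕ → ℂ) (k : ℕ) : ℝ≥0∞ := ENNReal.ofReal (‖c k‖ * wk α p k)

lemma exists_coef {f : ℂ → ℂ} (hf : Differentiable ℂ f) : ∃ c, Coef c f := by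
  refine ⟨fun k => ((Nat.factorial k : ℂ))⁻¹ * iteratedDeriv k f 0, fun z => ?_⟩
  have := Complex.hasSum_taylorSeries_of_entire hf 0 z
  refine this.congr_fun ?_ |> fun h => h
  intro k
  simp only [sub_zero, smul_eq_mul]; ring

lemma eval_le {α p : ℝ} (hα : 0 < α) (hp : 0 < p) (D : ℝ) : ∃ C : ℝ, 0 < C ∧
    ∀ c f, Coef c f → ∀ (z : ℂ) (n : ℕ), |logPlus ‖z‖ - n / (2 * α)| ≤ D →
      ENNReal.ofReal (‖f z‖ * Wt α p z) ≤ ENNReal.ofReal C * ∑' k, Kr 1 n k * bet α p c k := by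
  obtain ⟨C, hC, hK⟩ := kernel_upper hα hp D
  refine ⟨C, hC, fun c f hcf z n hz => ?_⟩
  rw [ENNReal.ofReal_mul (norm_nonneg _), ofReal_norm, ← (hcf z).tsum_eq,
    ← ENNReal.tsum_mul_left]
  calc _ ≤ (∑' k, ‖c k * z ^ k‖ₑ) * ENNReal.ofReal (Wt α p z) := by
        gcongr; exact enorm_tsum_le_tsum_enorm
    _ = ∑' k, ‖c k * z ^ k‖ₑ * ENNReal.ofReal (Wt α p z) := ENNReal.tsum_mul_right.symm
    _ ≤ _ := by
        refine ENNReal.tsum_le_tsum fun k => ?_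
        unfold Kr bet
        rw [← ofReal_norm, ← ENNReal.ofReal_mul (norm_nonneg _),
          ← ENNReal.ofReal_mul (Real.exp_pos _).le, ← ENNReal.ofReal_mul hC.le]
        apply ENNReal.ofReal_le_ofReal
        rw [norm_mul, norm_pow, mul_assoc]
        have := mul_le_mul_of_nonneg_left (hK z n k hz) (norm_nonneg (c k))
        refine this.trans (le_of_eq ?_)
        rw [one_mul]; ring

lemma floor_logPlus {α : ℝ} (hα : 0 < α) (z : ℂ) : ∃ n : ℕ,
    (n : ℝ) / (2 * α) ≤ logPlus ‖z‖ ∧ logPlus ‖z‖ < (n + 1 : ℝ) / (2 * α) ∧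
    |logPlus ‖z‖ - n / (2 * α)| ≤ 1 / (2 * α) := by
  have h0 : 0 ≤ logPlus ‖z‖ := le_max_right _ _
  have h2 : 0 < 2 * α := by positivity
  have h1 : (⌊2 * α * logPlus ‖z‖⌋₊ : ℝ) / (2 * α) ≤ logPlus ‖z‖ := by
    rw [div_le_iff₀ h2, mul_comm]
    exact Nat.floor_le (by positivity)
  have h3 : logPlus ‖z‖ < (⌊2 * α * logPlus ‖z‖⌋₊ + 1 : ℝ) / (2 * α) := by
    rw [lt_div_iff₀ h2, mul_comm]
    exact Nat.lt_floor_add_one _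
  refine ⟨_, h1, h3, ?_⟩
  rw [abs_of_nonneg (by linarith)]
  rw [add_div] at h3
  linarith

lemma fock_integrand {α p : ℝ} (hp : 0 < p) (w : ℝ) (hw : 0 ≤ w) (z : ℂ) :
    (w * Real.exp (-(phi α z))) ^ p = (w * Wt α p z) ^ p * ((1 + ‖z‖) ^ 2)⁻¹ := by
  unfold Wt
  have h1 : 0 < 1 + ‖z‖ := by positivity
  rw [← mul_assoc, Real.mul_rpow (x := w * Real.exp (-phi α z)) (by positivity) (by positivity),
    ← Real.rpow_mul h1.le,
    div_mul_cancel₀ _ hp.ne']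
  have : (1 + ‖z‖) ^ (2 : ℝ) = (1 + ‖z‖) ^ 2 := by norm_cast
  rw [this]
  field_simp

lemma fock_upper {α p : ℝ} (hα : 0 < α) (hp : 1 < p) : ∃ C : ℝ, 0 < C ∧
    ∀ c f, Coef c f → fockNormP α p f ≤ ENNReal.ofReal C * ∑' k, bet α p c k ^ p := by
  have hp0 : 0 < p := by linarith
  obtain ⟨C, hC, hK⟩ := eval_le hα hp0 (1 / (2 * α))
  obtain ⟨S, hS, hsch⟩ := schur one_pos hp
  refine ⟨C ^ p * S * (Real.exp (1 / α) * Real.pi), by positivity, fun c f hcf => ?_⟩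
  set h : ℕ → ℝ≥0∞ := fun n => (ENNReal.ofReal C * ∑' k, Kr 1 n k * bet α p c k) ^ p with hh
  have key : ∀ z : ℂ, ENNReal.ofReal ((‖f z‖ * Real.exp (-(phi α z))) ^ p) ≤
      ∑' n : ℕ, (Metric.ball (0 : ℂ) (Real.exp ((n + 1 : ℝ) / (2 * α)))).indicator
        (fun _ => h n * ENNReal.ofReal (Real.exp (-(n / α)))) z := by
    intro z
    obtain ⟨n, h1, h2, h3⟩ := floor_logPlus hα z
    refine le_trans ?_ (ENNReal.le_tsum n)
    have hzy : ‖z‖ ≤ Real.exp (logPlus ‖z‖) := by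
      rw [exp_logPlus (norm_nonneg _)]; exact le_max_right _ _
    rw [Set.indicator_of_mem (by
      rw [mem_ball_zero_iff]; exact hzy.trans_lt (Real.exp_lt_exp.2 h2))]
    rw [fock_integrand hp0 _ (norm_nonneg _), ENNReal.ofReal_mul (by have := Wt_pos α p z; positivity)]
    have hW := Wt_pos α p z
    rw [← ENNReal.ofReal_rpow_of_nonneg (by positivity) hp0.le]
    refine mul_le_mul' (ENNReal.rpow_le_rpow (hK c f hcf z n h3) hp0.le) ?_
    apply ENNReal.ofReal_le_ofReal
    rw [Real.exp_neg]
    apply inv_anti₀ (Real.exp_pos _)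
    have e1 : Real.exp (n / α) = Real.exp (n / (2 * α)) ^ 2 := by
      rw [← Real.exp_nat_mul]; congr 1; field_simp; norm_num
    rw [e1]
    gcongr
    refine (Real.exp_le_exp.2 h1).trans ?_
    rw [exp_logPlus (norm_nonneg _)]
    exact max_le (by linarith [norm_nonneg z]) (by linarith)
  unfold fockNormP
  refine (lintegral_mono key).trans ?_
  rw [lintegral_tsum (fun n => (measurable_const.indicator measurableSet_ball).aemeasurable)]
  have e : ∀ n : ℕ, ∫⁻ z, (Metric.ball (0 : ℂ) (Real.exp ((n + 1 : ℝ) / (2 * α)))).indicator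
        (fun _ => h n * ENNReal.ofReal (Real.exp (-(n / α)))) z =
        h n * ENNReal.ofReal (Real.exp (1 / α) * Real.pi) := by
    intro n
    rw [lintegral_indicator_const measurableSet_ball, Complex.volume_ball, mul_assoc]
    congr 1
    rw [← ENNReal.ofReal_pow (Real.exp_pos _).le, ← NNReal.coe_real_pi,
      ← ENNReal.ofReal_coe_nnreal, ← ENNReal.ofReal_mul (by positivity),
      ← ENNReal.ofReal_mul (by positivity), ← mul_assoc]
    congr 2
    rw [← Real.exp_nat_mul, ← Real.exp_add]
    congr 1
    field_simp
    push_cast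
    ring
  simp_rw [e]
  rw [ENNReal.tsum_mul_right, mul_comm, ENNReal.ofReal_mul (p := C ^ p * S) (by positivity),
    ENNReal.ofReal_mul (p := C ^ p) (by positivity)]
  have e2 : ∑' n, h n = ENNReal.ofReal C ^ p * ∑' n, (∑' k, Kr 1 n k * bet α p c k) ^ p := by
    rw [← ENNReal.tsum_mul_left]
    refine tsum_congr fun n => ?_
    rw [hh]; simp only
    rw [ENNReal.mul_rpow_of_nonneg _ _ hp0.le]
  rw [e2, ← ENNReal.ofReal_rpow_of_nonneg hC.le hp0.le]
  calc _ ≤ ENNReal.ofReal (Real.exp (1 / α) * Real.pi) *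
        (ENNReal.ofReal C ^ p * (ENNReal.ofReal S * ∑' k, bet α p c k ^ p)) := by
        gcongr; exact hsch _
    _ = _ := by ring

lemma lintegral_jensen {Ω : Type*} [MeasurableSpace Ω] {μ : Measure Ω} [IsProbabilityMeasure μ]
    {p : ℝ} (hp : 1 < p) {g : Ω → ℝ≥0∞} (hg : AEMeasurable g μ) :
    (∫⁻ t, g t ∂μ) ^ p ≤ ∫⁻ t, g t ^ p ∂μ := by
  have hp0 : 0 < p := by linarith
  have hpq : p.HolderConjugate (Real.conjExponent p) := Real.HolderConjugate.conjExponent hp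
  have H := ENNReal.lintegral_mul_le_Lp_mul_Lq μ hpq hg (aemeasurable_const (b := (1 : ℝ≥0∞)))
  simp only [Pi.mul_apply, mul_one, ENNReal.one_rpow, lintegral_const, measure_univ] at H
  have H2 := ENNReal.rpow_le_rpow H hp0.le
  rwa [← ENNReal.rpow_mul, one_div_mul_cancel hp0.ne', ENNReal.rpow_one] at H2

lemma coef_integral {c : ℕ → ℂ} {f : ℂ → ℂ} (h : Coef c f) (z : ℂ) (k : ℕ) :
    c k * z ^ k = ∫ t in (0:ℝ)..1, Complex.exp (-(2 * Real.pi * k * t * I)) *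
      f (Complex.exp (2 * Real.pi * t * I) * z) := by
  have hsum : Summable (fun j => ‖c j * z ^ j‖) := (h z).summable.norm
  have H := intervalIntegral.hasSum_integral_of_dominated_convergence (μ := volume) (a := 0) (b := 1)
    (F := fun j (t : ℝ) => Complex.exp (-(2 * Real.pi * k * t * I)) *
      (c j * (Complex.exp (2 * Real.pi * t * I) * z) ^ j))
    (f := fun t : ℝ => Complex.exp (-(2 * Real.pi * k * t * I)) *
      f (Complex.exp (2 * Real.pi * t * I) * z))
    (fun j _ => ‖c j * z ^ j‖) (fun j => by
      apply Continuous.aestronglyMeasurable; fun_prop)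
    (fun j => Filter.Eventually.of_forall fun t _ => by
      have e1 : ‖Complex.exp (-(2 * Real.pi * k * t * I))‖ = 1 := by
        have := Complex.norm_exp_ofReal_mul_I (-(2 * Real.pi * k * t))
        rw [← this]; congr 2; push_cast; ring
      have e2 : ‖Complex.exp (2 * Real.pi * t * I)‖ = 1 := by
        have := Complex.norm_exp_ofReal_mul_I (2 * Real.pi * t)
        rw [← this]; congr 2; push_cast; ring
      simp [e1, e2])
    (Filter.Eventually.of_forall fun t _ => hsum)
    (by simp)
    (Filter.Eventually.of_forall fun t _ => (h _).mul_left _)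
  rw [← H.tsum_eq, tsum_eq_single k]
  · have : ∀ t : ℝ, Complex.exp (-(2 * Real.pi * k * t * I)) *
      (c k * (Complex.exp (2 * Real.pi * t * I) * z) ^ k) = c k * z ^ k := by
      intro t
      rw [mul_pow, ← Complex.exp_nat_mul]
      have : Complex.exp (-(2 * Real.pi * k * t * I)) * Complex.exp (k * (2 * Real.pi * t * I)) = 1 := by
        rw [← Complex.exp_add]
        convert Complex.exp_zero using 2
        ring
      linear_combination (c k * z ^ k) * this
    simp [this]
  · intro j hj
    have hne : (2 * Real.pi * ((j : ℂ) - k) * I) ≠ 0 := by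
      have : (j : ℂ) - k ≠ 0 := sub_ne_zero.2 (by exact_mod_cast hj)
      have h2 : (Real.pi : ℂ) ≠ 0 := by exact_mod_cast Real.pi_ne_zero
      simp [this, h2]
    have : ∀ t : ℝ, Complex.exp (-(2 * Real.pi * k * t * I)) *
      (c j * (Complex.exp (2 * Real.pi * t * I) * z) ^ j) =
      (c j * z ^ j) * Complex.exp ((2 * Real.pi * ((j : ℂ) - k) * I) * t) := by
      intro t
      rw [mul_pow, ← Complex.exp_nat_mul]
      have : Complex.exp (-(2 * Real.pi * k * t * I)) * Complex.exp (j * (2 * Real.pi * t * I)) =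
          Complex.exp ((2 * Real.pi * ((j : ℂ) - k) * I) * t) := by
        rw [← Complex.exp_add]
        congr 1
        ring
      rw [← this]; ring
    simp_rw [this]
    rw [intervalIntegral.integral_const_mul, integral_exp_mul_complex hne]
    have e : Complex.exp (2 * Real.pi * ((j : ℂ) - k) * I * ((1 : ℝ) : ℂ)) = 1 := by
      rw [Complex.exp_eq_one_iff]
      refine ⟨(j : ℤ) - k, ?_⟩
      push_cast; ring
    rw [e]; simp

lemma coef_jensen {c : ℕ → ℂ} {f : ℂ → ℂ} (h : Coef c f) (hf : Continuous f) {p : ℝ} (hp : 1 < p)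
    (z : ℂ) (k : ℕ) :
    ‖c k * z ^ k‖ₑ ^ p ≤ ∫⁻ t in Set.Ioc (0 : ℝ) 1, ‖f (Complex.exp (2 * Real.pi * t * I) * z)‖ₑ ^ p := by
  have : IsProbabilityMeasure (volume.restrict (Set.Ioc (0:ℝ) 1)) := ⟨by simp⟩
  rw [coef_integral h z k, intervalIntegral.integral_of_le zero_le_one]
  refine le_trans (ENNReal.rpow_le_rpow (enorm_integral_le_lintegral_enorm _) (by linarith)) ?_
  refine (lintegral_jensen hp (by
    apply Measurable.aemeasurable
    apply Continuous.measurable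
    fun_prop)).trans (le_of_eq ?_)
  refine lintegral_congr fun t => ?_
  congr 1
  rw [enorm_mul]
  have e1 : ‖Complex.exp (-(2 * Real.pi * k * t * I))‖ₑ = 1 := by
    have := Complex.norm_exp_ofReal_mul_I (-(2 * Real.pi * k * t))
    rw [← ofReal_norm, show (1 : ℝ≥0∞) = ENNReal.ofReal 1 by simp, ← this]
    congr 3; push_cast; ring
  rw [e1, one_mul]

/-- the annulus on which the `k`-th monomial lives -/
def Ann (α p : ℝ) (k : ℕ) : Set ℂ :=
  {z | Real.exp ((k + 2 / p) / (2 * α)) ≤ ‖z‖ ∧ ‖z‖ < Real.exp ((k + 1 + 2 / p) / (2 * α))}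

lemma measurableSet_Ann (α p : ℝ) (k : ℕ) : MeasurableSet (Ann α p k) :=
  (measurableSet_le measurable_const measurable_norm).inter
    (measurableSet_lt measurable_norm measurable_const)

lemma pairwise_Ann {α : ℝ} (hα : 0 < α) (p : ℝ) :
    Pairwise (Function.onFun Disjoint (Ann α p)) := by
  have key : ∀ j k : ℕ, j < k → Disjoint (Ann α p j) (Ann α p k) := by
    intro j k h
    rw [Set.disjoint_left]
    rintro z ⟨_, h1⟩ ⟨h2, _⟩
    have h3 := Real.exp_lt_exp.1 (h2.trans_lt h1)
    have h4 : ((j : ℝ) + 1) ≤ k := by exact_mod_cast h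
    rw [div_lt_div_iff_of_pos_right (by positivity)] at h3
    linarith
  intro j k h
  rcases lt_or_gt_of_ne h with h | h
  · exact key j k h
  · exact (key k j h).symm

lemma lintegral_rot (F : ℂ → ℝ≥0∞) (t : ℝ) :
    ∫⁻ z, F (Complex.exp (2 * Real.pi * t * I) * z) = ∫⁻ z, F z := by
  have e2 : ‖Complex.exp (2 * Real.pi * t * I)‖ = 1 := by
    have := Complex.norm_exp_ofReal_mul_I (2 * Real.pi * t)
    rw [← this]; congr 2; push_cast; ring
  let u : Circle := ⟨Complex.exp (2 * Real.pi * t * I), mem_sphere_zero_iff_norm.2 e2⟩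
  have := (rotation u).measurePreserving.lintegral_comp_emb
    (rotation u).toHomeomorph.measurableEmbedding F
  have h : ∀ z, rotation u z = Complex.exp (2 * Real.pi * t * I) * z := fun z => rotation_apply u z
  simp_rw [h] at this
  exact this

lemma ann_coef {α p : ℝ} (hp : 1 < p) {c : ℕ → ℂ} {f : ℂ → ℂ} (h : Coef c f) (hf : Continuous f)
    (k : ℕ) :
    ∫⁻ z in Ann α p k, ENNReal.ofReal ((‖c k * z ^ k‖ * Real.exp (-(phi α z))) ^ p) ≤
    ∫⁻ z in Ann α p k, ENNReal.ofReal ((‖f z‖ * Real.exp (-(phi α z))) ^ p) := by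
  have hp0 : 0 < p := by linarith
  set V : ℂ → ℝ≥0∞ := (Ann α p k).indicator
    (fun z => ENNReal.ofReal (Real.exp (-(phi α z))) ^ p) with hV
  have hVm : Measurable V := by
    apply Measurable.indicator _ (measurableSet_Ann α p k)
    unfold phi logPlus
    fun_prop
  have e0 : ∀ g : ℂ → ℂ, ∫⁻ z in Ann α p k, ENNReal.ofReal ((‖g z‖ * Real.exp (-(phi α z))) ^ p) =
      ∫⁻ z, ‖g z‖ₑ ^ p * V z := by
    intro g
    rw [← lintegral_indicator (measurableSet_Ann α p k)]
    refine lintegral_congr fun z => ?_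
    by_cases hz : z ∈ Ann α p k
    · rw [Set.indicator_of_mem hz, hV, Set.indicator_of_mem hz,
        ← ENNReal.ofReal_rpow_of_nonneg (by positivity) hp0.le, ENNReal.ofReal_mul (norm_nonneg _),
        ENNReal.mul_rpow_of_nonneg _ _ hp0.le, ofReal_norm]
    · rw [Set.indicator_of_notMem hz, hV, Set.indicator_of_notMem hz, mul_zero]
  rw [e0 f, e0 (fun z => c k * z ^ k)]
  have hVr : ∀ (t : ℝ) z, V (Complex.exp (2 * Real.pi * t * I) * z) = V z := by
    intro t z
    have e2 : ‖Complex.exp (2 * Real.pi * t * I)‖ = 1 := by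
      have := Complex.norm_exp_ofReal_mul_I (2 * Real.pi * t)
      rw [← this]; congr 2; push_cast; ring
    have e3 : ‖Complex.exp (2 * Real.pi * t * I) * z‖ = ‖z‖ := by rw [norm_mul, e2, one_mul]
    have e4 : Complex.exp (2 * Real.pi * t * I) * z ∈ Ann α p k ↔ z ∈ Ann α p k := by
      unfold Ann; simp only [Set.mem_ofPred_eq, e3]
    by_cases hz : z ∈ Ann α p k
    · rw [hV, Set.indicator_of_mem hz, Set.indicator_of_mem (e4.2 hz)]
      unfold phi; rw [e3]
    · rw [hV, Set.indicator_of_notMem hz, Set.indicator_of_notMem (fun h => hz (e4.1 h))]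
  calc ∫⁻ z, ‖c k * z ^ k‖ₑ ^ p * V z
      ≤ ∫⁻ z, (∫⁻ t in Set.Ioc (0 : ℝ) 1, ‖f (Complex.exp (2 * Real.pi * t * I) * z)‖ₑ ^ p) * V z := by
        refine lintegral_mono fun z => ?_
        exact mul_le_mul' (coef_jensen h hf hp z k) le_rfl
    _ = ∫⁻ z, ∫⁻ t in Set.Ioc (0 : ℝ) 1, ‖f (Complex.exp (2 * Real.pi * t * I) * z)‖ₑ ^ p * V z := by
        refine lintegral_congr fun z => ?_
        rw [lintegral_mul_const]
        have : Continuous fun t : ℝ => f (Complex.exp (2 * Real.pi * t * I) * z) := by fun_prop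
        exact this.measurable.enorm.pow_const _
    _ = ∫⁻ t in Set.Ioc (0 : ℝ) 1, ∫⁻ z, ‖f (Complex.exp (2 * Real.pi * t * I) * z)‖ₑ ^ p * V z := by
        rw [lintegral_lintegral_swap]
        apply Measurable.aemeasurable
        have : Continuous fun q : ℂ × ℝ => f (Complex.exp (2 * Real.pi * q.2 * I) * q.1) := by fun_prop
        exact (this.measurable.enorm.pow_const _).mul (hVm.comp measurable_fst)
    _ = ∫⁻ t in Set.Ioc (0 : ℝ) 1, ∫⁻ z, ‖f z‖ₑ ^ p * V z := by
        refine lintegral_congr fun t => ?_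
        rw [← lintegral_rot (fun z => ‖f z‖ₑ ^ p * V z) t]
        simp only [hVr]
    _ = _ := by simp

lemma coef_le_fock {α p : ℝ} (hα : 0 < α) (hp : 1 < p) : ∃ C : ℝ, 0 < C ∧
    ∀ c f, Coef c f → Continuous f →
      ∑' k, bet α p c k ^ p ≤ ENNReal.ofReal C * fockNormP α p f := by
  have hp0 : 0 < p := by linarith
  obtain ⟨κ, hκ, hK⟩ := kernel_lower (p := p) hα hp0 0
  set A : ℝ := (κ * Real.exp (-(1 / (4 * α)))) ^ p * (Real.pi * (1 - Real.exp (-(1 / α))) / 4) with hA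
  have hexp : Real.exp (-(1 / α)) < 1 := by
    rw [Real.exp_lt_one_iff]; have : 0 < 1 / α := by positivity
    linarith
  have hexp' : 0 < 1 - Real.exp (-(1 / α)) := by linarith
  have hApos : 0 < A := by positivity
  refine ⟨A⁻¹, by positivity, fun c f hcf hf => ?_⟩
  have key : ∀ k, ENNReal.ofReal A * bet α p c k ^ p ≤
      ∫⁻ z in Ann α p k, ENNReal.ofReal ((‖f z‖ * Real.exp (-(phi α z))) ^ p) := by
    intro k
    refine le_trans ?_ (ann_coef hp hcf hf k)
    set R := Real.exp ((k + 1 + 2 / p) / (2 * α)) with hR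
    set r := Real.exp ((k + 2 / p) / (2 * α)) with hr
    have hR1 : 1 ≤ R := Real.one_le_exp (by positivity)
    have hrR : r ≤ R := Real.exp_le_exp.2 (by gcongr; linarith)
    have hR0 : 0 < R := Real.exp_pos _
    have hr0 : 0 < r := Real.exp_pos _
    have hvol : volume (Ann α p k) = ENNReal.ofReal ((R ^ 2 - r ^ 2) * Real.pi) := by
      have : Ann α p k = Metric.ball 0 R \ Metric.ball 0 r := by
        ext z
        simp only [Ann, Set.mem_ofPred_eq, Set.mem_sdiff, mem_ball_zero_iff, not_lt]
        tauto
      rw [this, measure_sdiff (Metric.ball_subset_ball hrR) measurableSet_ball.nullMeasurableSet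
        (measure_ball_lt_top).ne, Complex.volume_ball, Complex.volume_ball,
        ← ENNReal.ofReal_pow hR0.le, ← ENNReal.ofReal_pow hr0.le, ← ENNReal.ofReal_coe_nnreal,
        NNReal.coe_real_pi, ← ENNReal.ofReal_mul (by positivity), ← ENNReal.ofReal_mul (by positivity),
        ← ENNReal.ofReal_sub _ (by positivity)]
      congr 1; ring
    have hpt : ∀ z ∈ Ann α p k,
        ENNReal.ofReal ((‖c k‖ * wk α p k * (κ * Real.exp (-(1 / (4 * α))))) ^ p * ((2 * R) ^ 2)⁻¹) ≤
        ENNReal.ofReal ((‖c k * z ^ k‖ * Real.exp (-(phi α z))) ^ p) := by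
      rintro z ⟨h1, h2⟩
      apply ENNReal.ofReal_le_ofReal
      rw [fock_integrand hp0 _ (norm_nonneg _)]
      have hz0 : 0 < ‖z‖ := hr0.trans_le h1
      have hz : z ≠ 0 := norm_pos_iff.1 hz0
      have hw := wk_pos α p k
      have l1 : (k + 2 / p) / (2 * α) ≤ Real.log ‖z‖ := by
        rw [Real.le_log_iff_exp_le hz0]; exact h1
      have l2 : Real.log ‖z‖ < (k + 1 + 2 / p) / (2 * α) := by
        rw [Real.log_lt_iff_lt_exp hz0]; exact h2
      have l0 : 0 ≤ (k + 2 / p) / (2 * α) := by positivity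
      have hk := hK z k hz (by linarith)
      have hbase : ‖c k‖ * wk α p k * (κ * Real.exp (-(1 / (4 * α)))) ≤ ‖c k * z ^ k‖ * Wt α p z := by
        rw [norm_mul, norm_pow, mul_assoc, mul_assoc]
        refine mul_le_mul_of_nonneg_left ?_ (norm_nonneg _)
        refine le_trans ?_ hk
        rw [← mul_assoc, mul_comm (wk α p k)]
        gcongr
        set u := Real.log ‖z‖ - (k + 2 / p) / (2 * α) with hu
        have u0 : 0 ≤ u := by linarith
        have u1 : u ≤ 1 / (2 * α) := by
          have : (k + 1 + 2 / p) / (2 * α) = (k + 2 / p) / (2 * α) + 1 / (2 * α) := by ring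
          linarith
        have : α * u ^ 2 ≤ α * (1 / (2 * α)) ^ 2 := by gcongr
        have e : α * (1 / (2 * α)) ^ 2 = 1 / (4 * α) := by field_simp; norm_num
        linarith
      exact mul_le_mul (Real.rpow_le_rpow (by positivity) hbase hp0.le)
        (inv_anti₀ (by positivity) (by gcongr; linarith)) (by positivity)
        (by have := Wt_pos α p z; positivity)
    refine le_trans ?_ (setLIntegral_mono' (measurableSet_Ann α p k) hpt)
    rw [setLIntegral_const, hvol]
    unfold bet
    have hw := wk_pos α p k
    have hrr : r ^ 2 ≤ R ^ 2 := by gcongr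
    have hrr' : r ^ 2 = R ^ 2 * Real.exp (-(1 / α)) := by
      rw [hr, hR, ← Real.exp_nat_mul, ← Real.exp_nat_mul, ← Real.exp_add]
      congr 1; field_simp; push_cast; ring
    rw [ENNReal.ofReal_rpow_of_nonneg (by positivity) hp0.le, ← ENNReal.ofReal_mul hApos.le,
      ← ENNReal.ofReal_mul (by positivity)]
    apply ENNReal.ofReal_le_ofReal
    rw [Real.mul_rpow (x := ‖c k‖ * wk α p k) (by positivity) (by positivity), hrr', hA]
    apply le_of_eq
    field_simp
    ring
  calc ∑' k, bet α p c k ^ p = ENNReal.ofReal A⁻¹ * ∑' k, ENNReal.ofReal A * bet α p c k ^ p := by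
        rw [ENNReal.tsum_mul_left, ← mul_assoc, ← ENNReal.ofReal_mul (by positivity),
          inv_mul_cancel₀ hApos.ne']
        simp
    _ ≤ ENNReal.ofReal A⁻¹ * ∑' k, ∫⁻ z in Ann α p k,
          ENNReal.ofReal ((‖f z‖ * Real.exp (-(phi α z))) ^ p) := by
        gcongr with k; exact key k
    _ ≤ _ := by
        gcongr
        rw [← lintegral_iUnion (measurableSet_Ann α p) (pairwise_Ann hα p)]
        exact setLIntegral_le_lintegral _ _

/-- the enumerated sequences: `μ` with moduli `exp (x j)` -/
structure PSeq (μ : ℕ → ℂ) (x : ℕ → ℝ) : Prop where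
  mono : Monotone x
  h0 : ‖μ 0‖ ≤ Real.exp (x 0)
  h1 : ∀ j, 1 ≤ j → ‖μ j‖ = Real.exp (x j)
  inj : Function.Injective μ

lemma PSeq.le {μ : ℕ → ℂ} {x : ℕ → ℝ} (S : PSeq μ x) (j : ℕ) : ‖μ j‖ ≤ Real.exp (x j) := by
  rcases Nat.eq_zero_or_pos j with h | h
  · subst h; exact S.h0
  · exact (S.h1 j h).le

/-- bounded density -/
def Dens (x : ℕ → ℝ) : Prop :=
  ∃ C : ℝ, 0 < C ∧ ∀ (m : ℕ) (F : Finset ℕ), ∑ j ∈ F, Real.exp (-|x m - x j|) ≤ C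

lemma max_sum {x : ℕ → ℝ} (hx : Monotone x) {k N : ℕ} (h : k ≤ N) :
    ∑ j ∈ Finset.range (N + 1), max (x k) (x j) =
      (k + 1) * x k + ∑ j ∈ Finset.range (N + 1), x j - ∑ j ∈ Finset.range (k + 1), x j := by
  induction N, h using Nat.le_induction with
  | base =>
    have : ∀ j ∈ Finset.range (k + 1), max (x k) (x j) = x k := by
      intro j hj
      exact max_eq_left (hx (by simp at hj; omega))
    rw [Finset.sum_congr rfl this]; simp
  | succ N hN ih =>
    rw [Finset.sum_range_succ, ih, Finset.sum_range_succ _ (N + 1),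
      max_eq_right (hx (by omega))]
    ring

lemma exp_add_exp_le (u v : ℝ) :
    Real.exp u + Real.exp v ≤ Real.exp (max u v + Real.exp (-|u - v|)) := by
  have key : ∀ u v : ℝ, u ≤ v → Real.exp u + Real.exp v ≤ Real.exp (v + Real.exp (-(v - u))) := by
    intro u v h
    have e : Real.exp u = Real.exp v * Real.exp (-(v - u)) := by rw [← Real.exp_add]; ring_nf
    rw [Real.exp_add, e]
    have := Real.add_one_le_exp (Real.exp (-(v - u)))
    have h2 := Real.exp_pos v
    nlinarith
  rcases le_total u v with h | h
  · rw [max_eq_right h, abs_sub_comm, abs_of_nonneg (sub_nonneg.2 h)]; exact key u v h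
  · rw [max_eq_left h, abs_of_nonneg (sub_nonneg.2 h), add_comm]; exact key v u h

lemma exp_sub_exp_ge {u v : ℝ} (h : u ≤ v) :
    Real.exp (v + 1 - Real.exp (-|v - u|)) ≤ Real.exp (v + 1) - Real.exp u := by
  rw [abs_of_nonneg (sub_nonneg.2 h)]
  set t := Real.exp (-(v - u)) with ht
  have t0 : 0 < t := Real.exp_pos _
  have t1 : t ≤ 1 := Real.exp_le_one_iff.2 (by linarith)
  have e : Real.exp u = Real.exp (v + 1) * (t * Real.exp (-1)) := by
    rw [ht, ← Real.exp_add, ← Real.exp_add]; ring_nf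
  rw [e, sub_eq_add_neg, Real.exp_add]
  have h2 : Real.exp (-t) ≤ 1 - t * Real.exp (-1) := by
    have h3 : t * Real.exp (-1) ≤ t * Real.exp (-t) := by gcongr
    have h4 : (1 + t) * Real.exp (-t) ≤ 1 := by
      have := Real.add_one_le_exp t
      calc (1 + t) * Real.exp (-t) ≤ Real.exp t * Real.exp (-t) := by gcongr; linarith
        _ = 1 := by rw [← Real.exp_add]; simp
    linarith
  have := Real.exp_pos (v + 1)
  nlinarith

lemma exp_sub_exp_ge' {u v : ℝ} (h : u ≤ v) (h2 : Real.exp (-|v - u|) ≤ 1 / 2) :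
    Real.exp (v - 2 * Real.exp (-|v - u|)) ≤ Real.exp v - Real.exp u := by
  rw [abs_of_nonneg (sub_nonneg.2 h)] at *
  set t := Real.exp (-(v - u)) with ht
  have t0 : 0 < t := Real.exp_pos _
  have e : Real.exp u = Real.exp v * t := by
    rw [ht, ← Real.exp_add]; ring_nf
  rw [e, sub_eq_add_neg, Real.exp_add]
  have h4 : Real.exp (-(2 * t)) ≤ 1 - t := by
    have := Real.add_one_le_exp (2 * t)
    rw [Real.exp_neg, inv_le_comm₀ (Real.exp_pos _) (by linarith)]
    refine le_trans ?_ this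
    rw [inv_le_comm₀ (by linarith) (by linarith), inv_le_iff_one_le_mul₀ (by linarith)]
    nlinarith
  have := Real.exp_pos v
  nlinarith

lemma PSeq.sub_le {μ : ℕ → ℂ} {x : ℕ → ℝ} (S : PSeq μ x) (i j : ℕ) :
    ‖μ i - μ j‖ ≤ Real.exp (max (x i) (x j) + Real.exp (-|x i - x j|)) :=
  (norm_sub_le _ _).trans ((add_le_add (S.le i) (S.le j)).trans (exp_add_exp_le _ _))

/-- relative separation -/
def RSep (μ : ℕ → ℂ) (x : ℕ → ℝ) : Prop :=
  ∃ ε : ℝ, 0 < ε ∧ ∀ i j, i < j → ε * Real.exp (x j) ≤ ‖μ j - μ i‖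

lemma PSeq.sub_ge {μ : ℕ → ℂ} {x : ℕ → ℝ} (S : PSeq μ x) (hs : RSep μ x) :
    ∃ C : ℝ, 0 < C ∧ ∀ i j, i ≠ j →
      Real.exp (max (x i) (x j) - C * Real.exp (-|x i - x j|)) ≤ ‖μ i - μ j‖ := by
  obtain ⟨ε, hε, hs⟩ := hs
  refine ⟨max 2 (2 * |Real.log ε|), by positivity, ?_⟩
  have key : ∀ i j, i < j → Real.exp (x j - max 2 (2 * |Real.log ε|) * Real.exp (-|x j - x i|)) ≤
      ‖μ j - μ i‖ := by
    intro i j h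
    have hx := S.mono h.le
    have hpos := Real.exp_pos (-|x j - x i|)
    by_cases h2 : Real.exp (-|x j - x i|) ≤ 1 / 2
    · have h3 := exp_sub_exp_ge' hx h2
      have h4 : Real.exp (x j) - Real.exp (x i) ≤ ‖μ j - μ i‖ := by
        have := norm_sub_norm_le (μ j) (μ i)
        rw [S.h1 j (by omega)] at this
        have := S.le i
        linarith
      refine le_trans ?_ (h3.trans h4)
      apply Real.exp_le_exp.2
      have := le_max_left 2 (2 * |Real.log ε|)
      nlinarith
    · push Not at h2
      refine le_trans ?_ (hs i j h)
      nth_rw 2 [← Real.exp_log hε]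
      rw [← Real.exp_add]
      apply Real.exp_le_exp.2
      have := le_max_right 2 (2 * |Real.log ε|)
      have h5 := neg_abs_le (Real.log ε)
      have h6 : 0 ≤ max 2 (2 * |Real.log ε|) := by positivity
      nlinarith
  intro i j h
  rcases lt_or_gt_of_ne h with h | h
  · rw [max_eq_right (S.mono h.le), abs_sub_comm, norm_sub_rev]; exact key i j h
  · rw [max_eq_left (S.mono h.le)]; exact key j i h

lemma Kr_sum_fin {κ : ℝ} (hκ : 0 < κ) : ∃ C : ℝ, 0 < C ∧ ∀ (m : ℕ) (F : Finset ℕ),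
    ∑ j ∈ F, Real.exp (-(κ * |(m : ℝ) - j|)) ≤ C := by
  obtain ⟨C, hC, h⟩ := Kr_sum hκ
  refine ⟨C, hC, fun m F => ?_⟩
  have h2 := (ENNReal.sum_le_tsum F).trans (h m)
  unfold Kr at h2
  rw [← ENNReal.ofReal_sum_of_nonneg (fun _ _ => by positivity)] at h2
  exact (ENNReal.ofReal_le_ofReal_iff hC.le).1 h2

lemma dens_of_bdd {α p M : ℝ} (hα : 0 < α) {x : ℕ → ℝ}
    (hd : ∀ j : ℕ, |x j - (j + 2 / p) / (2 * α)| ≤ M) : Dens x := by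
  obtain ⟨C, hC, h⟩ := Kr_sum_fin (κ := 1 / (2 * α)) (by positivity)
  refine ⟨Real.exp (2 * M) * C, by positivity, fun m F => ?_⟩
  refine le_trans ?_ (mul_le_mul_of_nonneg_left (h m F) (by positivity))
  rw [Finset.mul_sum]
  refine Finset.sum_le_sum fun j _ => ?_
  rw [← Real.exp_add]
  apply Real.exp_le_exp.2
  have e : 1 / (2 * α) * |(m : ℝ) - j| = |(m + 2 / p) / (2 * α) - (j + 2 / p) / (2 * α)| := by
    rw [← abs_of_pos (show 0 < 1 / (2 * α) by positivity), ← abs_mul]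
    congr 1; ring
  rw [e]
  have h1 := hd m
  have h2 := hd j
  have h3 := abs_sub_abs_le_abs_sub ((m + 2 / p) / (2 * α) - (j + 2 / p) / (2 * α)) (x m - x j)
  have h4 : |(m + 2 / p) / (2 * α) - (j + 2 / p) / (2 * α) - (x m - x j)| ≤ 2 * M := by
    rw [abs_le] at *
    constructor <;> linarith [h1.1, h1.2, h2.1, h2.2]
  linarith

/-- Weights at the nodes. -/
lemma PSeq.log_W {μ : ℕ → ℂ} {x : ℕ → ℝ} (S : PSeq μ x) {α p : ℝ} (hα : 0 < α) (hp : 0 < p) :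
    ∃ C : ℝ, 0 < C ∧ ∀ j, |Real.log (Wt α p (μ j)) - (-(α * x j ^ 2) + 2 / p * x j)| ≤ C := by
  obtain ⟨C, hC, h⟩ := log_Wt (p := p) hα hp (-(x 1))
  refine ⟨max C |Real.log (Wt α p (μ 0)) - (-(α * x 0 ^ 2) + 2 / p * x 0)|, by positivity, fun j => ?_⟩
  rcases Nat.eq_zero_or_pos j with h0 | h0
  · subst h0; exact le_max_right _ _
  · exact (h (μ j) (x j) (S.h1 j h0) (by have := S.mono h0; linarith)).trans (le_max_left _ _)

lemma disc_term {α p : ℝ} (hp : 0 < p) (z : ℂ) {y : ℝ} (hy : 0 ≤ y) :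
    (1 + ‖z‖) ^ 2 * y ^ p * Real.exp (-(p * phi α z)) = (y * Wt α p z) ^ p := by
  unfold Wt
  have h1 : 0 < 1 + ‖z‖ := by positivity
  rw [Real.mul_rpow hy (by positivity), Real.mul_rpow (by positivity) (by positivity),
    ← Real.rpow_mul h1.le, ← Real.exp_mul, div_mul_cancel₀ _ hp.ne']
  norm_num
  rw [mul_comm p]; ring

lemma disc_eq {μ : ℕ → ℂ} (hμ : Function.Injective μ) {α p : ℝ} (hp : 0 < p) (f : ℂ → ℂ) :
    ∑' lam : Set.range μ, ENNReal.ofReal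
      ((1 + ‖(lam : ℂ)‖) ^ 2 * ‖f (lam : ℂ)‖ ^ p * Real.exp (-(p * phi α (lam : ℂ)))) =
    ∑' j, ENNReal.ofReal (‖f (μ j)‖ * Wt α p (μ j)) ^ p := by
  rw [← (Equiv.ofInjective μ hμ).tsum_eq]
  refine tsum_congr fun j => ?_
  have := Wt_pos α p (μ j)
  rw [Equiv.ofInjective_apply, disc_term hp _ (norm_nonneg _),
    ENNReal.ofReal_rpow_of_nonneg (by positivity) hp.le]

lemma coeff_prod_le (μ : ℕ → ℂ) {R : ℝ} (hR : 0 ≤ R) (F : Finset ℕ) : ∀ k : ℕ,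
    ‖(∏ j ∈ F, (Polynomial.X - Polynomial.C (μ j))).coeff k‖ * R ^ k ≤ ∏ j ∈ F, (R + ‖μ j‖) := by
  induction F using Finset.induction_on with
  | empty =>
    intro k
    rcases Nat.eq_zero_or_pos k with h | h
    · subst h; simp
    · simp [Polynomial.coeff_one, h.ne']
  | insert i F hi ih =>
    intro k
    rw [Finset.prod_insert hi, Finset.prod_insert hi]
    set Q := ∏ j ∈ F, (Polynomial.X - Polynomial.C (μ j)) with hQ
    set PP := ∏ j ∈ F, (R + ‖μ j‖) with hPi
    have hk := ih k
    cases k with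
    | zero =>
      have e : ((Polynomial.X - Polynomial.C (μ i)) * Q).coeff 0 = - (μ i * Q.coeff 0) := by
        rw [sub_mul, Polynomial.coeff_sub]; simp
      rw [e, norm_neg, norm_mul]
      have h0 : 0 ≤ PP := le_trans (by positivity) hk
      have := norm_nonneg (μ i)
      nlinarith
    | succ k =>
      have e : ((Polynomial.X - Polynomial.C (μ i)) * Q).coeff (k + 1)
          = Q.coeff k - μ i * Q.coeff (k + 1) := by
        rw [sub_mul, Polynomial.coeff_sub]; simp
      have hk' := ih k
      rw [e]
      calc ‖Q.coeff k - μ i * Q.coeff (k + 1)‖ * R ^ (k + 1)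
          ≤ (‖Q.coeff k‖ + ‖μ i‖ * ‖Q.coeff (k + 1)‖) * R ^ (k + 1) := by
            gcongr
            exact (norm_sub_le _ _).trans (by rw [norm_mul])
        _ = R * (‖Q.coeff k‖ * R ^ k) + ‖μ i‖ * (‖Q.coeff (k + 1)‖ * R ^ (k + 1)) := by ring
        _ ≤ R * PP + ‖μ i‖ * PP := by gcongr
        _ = _ := by ring

/-- partial sums of deviations -/
def sd (α p : ℝ) (x : ℕ → ℝ) (n : ℕ) : ℝ := ∑ j ∈ Finset.range n, (x j - (j + 2 / p) / (2 * α))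

lemma sum_x (α p : ℝ) (x : ℕ → ℝ) (n : ℕ) :
    ∑ j ∈ Finset.range n, x j = sd α p x n + (n * (n - 1) / 2 + 2 / p * n) / (2 * α) := by
  unfold sd
  induction n with
  | zero => simp
  | succ n ih =>
    rw [Finset.sum_range_succ, Finset.sum_range_succ, ih]
    push_cast
    ring

lemma lag_arith {α a τ k m sk sm xm dm : ℝ} (h : α * a = 1 / 2) (hxm : xm = a * (m + τ) + dm) :
    -(sk + a * (k * (k - 1) / 2 + τ * k)) + (sm + a * (m * (m - 1) / 2 + τ * m)) - (m - 1) * xm +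
      a / 2 * (k + τ) ^ 2 + (α * xm ^ 2 - τ * xm) =
    sm - sk + a * (k - m) / 2 + α * dm ^ 2 + xm := by
  subst hxm
  linear_combination (a * (m + τ) ^ 2 + 2 * (m + τ) * dm) * h

lemma lag_bound {μ : ℕ → ℂ} {x : ℕ → ℝ} (S : PSeq μ x) {α p M ε K : ℝ} (hα : 0 < α) (hp : 0 < p)
    (hd : ∀ j : ℕ, |x j - (j + 2 / p) / (2 * α)| ≤ M) (hs : RSep μ x)
    (hc : ∀ m n : ℕ, m ≤ n → |sd α p x n - sd α p x m| ≤ (1 / (4 * α) - ε) * (n - m) + K) :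
    ∃ C : ℝ, 0 < C ∧ ∀ N m k : ℕ, m ≤ N → k ≤ N →
      ‖(Lagrange.basis (Finset.range (N + 1)) μ m).coeff k‖ * wk α p k ≤
        C * Real.exp (-(ε * |(k : ℝ) - m|)) * Wt α p (μ m) := by
  obtain ⟨D, hD, hdens⟩ := dens_of_bdd hα hd
  obtain ⟨C1, hC1, hge⟩ := S.sub_ge hs
  obtain ⟨C2, hC2, hW⟩ := S.log_W hα hp
  set L := D + C1 * D + C2 + α * M ^ 2 + 2 * M + K with hL
  refine ⟨Real.exp L, Real.exp_pos _, fun N m k hm hk => ?_⟩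
  set F := (Finset.range (N + 1)).erase m with hF
  have hmem : m ∈ Finset.range (N + 1) := by simp; omega
  have e1 : Lagrange.basis (Finset.range (N + 1)) μ m =
      Polynomial.C (∏ j ∈ F, (μ m - μ j)⁻¹) * ∏ j ∈ F, (Polynomial.X - Polynomial.C (μ j)) := by
    rw [Lagrange.basis, map_prod, ← Finset.prod_mul_distrib]
    rfl
  have b1 := coeff_prod_le μ (Real.exp_pos (x k)).le F k
  have b2 : ∏ j ∈ F, (Real.exp (x k) + ‖μ j‖) ≤
      Real.exp (∑ j ∈ F, (max (x k) (x j) + Real.exp (-|x k - x j|))) := by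
    rw [Real.exp_sum]
    refine Finset.prod_le_prod (fun _ _ => by positivity) fun j _ => ?_
    exact (add_le_add le_rfl (S.le j)).trans (exp_add_exp_le _ _)
  have b3 : ‖∏ j ∈ F, (μ m - μ j)⁻¹‖ ≤
      Real.exp (∑ j ∈ F, -(max (x m) (x j) - C1 * Real.exp (-|x m - x j|))) := by
    rw [Real.exp_sum, norm_prod]
    refine Finset.prod_le_prod (fun _ _ => by positivity) fun j hj => ?_
    rw [norm_inv, Real.exp_neg]
    exact inv_anti₀ (Real.exp_pos _) (hge m j (Finset.ne_of_mem_erase hj).symm)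
  have s1 : ∑ j ∈ F, (max (x k) (x j) + Real.exp (-|x k - x j|)) ≤
      (k + 1) * x k + ∑ j ∈ Finset.range (N + 1), x j - ∑ j ∈ Finset.range (k + 1), x j
        - max (x k) (x m) + D := by
    rw [Finset.sum_add_distrib]
    have := Finset.add_sum_erase (Finset.range (N + 1)) (fun j => max (x k) (x j)) hmem
    rw [max_sum S.mono hk] at this
    have h2 := hdens k F
    linarith
  have s2 : ∑ j ∈ F, -(max (x m) (x j) - C1 * Real.exp (-|x m - x j|)) ≤
      -((m + 1) * x m + ∑ j ∈ Finset.range (N + 1), x j - ∑ j ∈ Finset.range (m + 1), x j)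
        + x m + C1 * D := by
    rw [Finset.sum_neg_distrib, Finset.sum_sub_distrib, ← Finset.mul_sum]
    have := Finset.add_sum_erase (Finset.range (N + 1)) (fun j => max (x m) (x j)) hmem
    simp only [max_self] at this
    rw [max_sum S.mono hm] at this
    have h2 := mul_le_mul_of_nonneg_left (hdens m F) hC1.le
    linarith
  have hWp := Wt_pos α p (μ m)
  have hlog := hW m
  rw [e1, Polynomial.coeff_C_mul, norm_mul]
  rw [← Real.exp_nat_mul] at b1
  have b4 : ‖(∏ j ∈ F, (Polynomial.X - Polynomial.C (μ j))).coeff k‖ ≤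
      Real.exp (∑ j ∈ F, (max (x k) (x j) + Real.exp (-|x k - x j|)) - k * x k) := by
    rw [Real.exp_sub, le_div_iff₀ (Real.exp_pos _)]
    exact b1.trans b2
  have hwk : wk α p k = Real.exp (((k : ℝ) + 2 / p) ^ 2 / (4 * α)) := rfl
  calc _ ≤ Real.exp (∑ j ∈ F, -(max (x m) (x j) - C1 * Real.exp (-|x m - x j|))) *
        Real.exp (∑ j ∈ F, (max (x k) (x j) + Real.exp (-|x k - x j|)) - k * x k) *
        Real.exp (((k : ℝ) + 2 / p) ^ 2 / (4 * α)) := by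
        rw [hwk]; gcongr
    _ ≤ Real.exp L * Real.exp (-(ε * |(k : ℝ) - m|)) * Real.exp (Real.log (Wt α p (μ m))) := by
        rw [← Real.exp_add, ← Real.exp_add, ← Real.exp_add, ← Real.exp_add]
        apply Real.exp_le_exp.2
        rw [Finset.sum_range_succ _ k] at s1
        rw [Finset.sum_range_succ _ m] at s2
        rw [sum_x α p x k] at s1
        rw [sum_x α p x m] at s2
        set a := 1 / (2 * α) with ha
        have haα : α * a = 1 / 2 := by rw [ha]; field_simp
        have hdm := hd m
        have hdk := hd k
        set dm := x m - (m + 2 / p) / (2 * α) with hdmd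
        set dk := x k - (k + 2 / p) / (2 * α) with hdkd
        have hxm : x m = a * (m + 2 / p) + dm := by rw [hdmd, ha]; ring
        have hxk : x k = a * (k + 2 / p) + dk := by rw [hdkd, ha]; ring
        have key := lag_arith (k := (k : ℝ)) (sk := sd α p x k) (sm := sd α p x m) haα hxm
        have r1 : ((k : ℝ) + 2 / p) ^ 2 / (4 * α) = a / 2 * (k + 2 / p) ^ 2 := by rw [ha]; field_simp; norm_num
        have r2 : ∀ y : ℝ, y / (2 * α) = a * y := by intro y; rw [ha]; ring
        rw [r1]
        rw [r2] at s1 s2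
        have hdm2 : α * dm ^ 2 ≤ α * M ^ 2 := by
          have : dm ^ 2 ≤ M ^ 2 := sq_le_sq' (by linarith [(abs_le.1 hdm).1]) (abs_le.1 hdm).2
          gcongr
        have l2 := (abs_le.1 hlog)
        have fin : sd α p x m - sd α p x k + a * (k - m) / 2 + x m - max (x k) (x m) ≤
            2 * M + K - ε * |(k : ℝ) - m| := by
          have a4 : 1 / (4 * α) = a / 2 := by rw [ha]; field_simp; norm_num
          rcases le_total m k with h | h
          · have hh := abs_le.1 (hc m k h)
            have hmk : (m : ℝ) ≤ k := by exact_mod_cast h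
            rw [a4] at hh
            rw [abs_of_nonneg (show (0 : ℝ) ≤ (k : ℝ) - m by linarith)]
            have := le_max_left (x k) (x m)
            have q1 := abs_le.1 hdm
            have q2 := abs_le.1 hdk
            rw [max_eq_left (S.mono h)]
            linarith [hh.1, hh.2, q1.1, q1.2, q2.1, q2.2]
          · have hh := abs_le.1 (hc k m h)
            have hmk : (k : ℝ) ≤ m := by exact_mod_cast h
            rw [a4] at hh
            rw [abs_of_nonpos (show (k : ℝ) - m ≤ 0 by linarith)]
            rw [max_eq_right (S.mono h)]
            have := (abs_nonneg _).trans hdm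
            linarith [hh.1, hh.2]
        linarith [l2.1, l2.2]
    _ = _ := by rw [Real.exp_log hWp]

lemma PSeq.near {μ : ℕ → ℂ} {x : ℕ → ℝ} (S : PSeq μ x) {α p M : ℝ} (hα : 0 < α) (hp : 0 < p)
    (hd : ∀ j : ℕ, |x j - (j + 2 / p) / (2 * α)| ≤ M) :
    ∃ D : ℝ, ∀ j : ℕ, |logPlus ‖μ j‖ - j / (2 * α)| ≤ D := by
  refine ⟨M + 2 / p / (2 * α) + |logPlus ‖μ 0‖|, fun j => ?_⟩
  have hM : 0 ≤ M := (abs_nonneg _).trans (hd 0)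
  have h0 : 0 ≤ 2 / p / (2 * α) := by positivity
  rcases Nat.eq_zero_or_pos j with h | h
  · subst h; simp; linarith
  · rw [S.h1 j h]
    unfold logPlus
    rw [Real.log_exp]
    have hj := hd j
    have e : (j + 2 / p) / (2 * α) = j / (2 * α) + 2 / p / (2 * α) := by ring
    rw [e] at hj
    have hpos : 0 ≤ (j : ℝ) / (2 * α) := by positivity
    have := abs_nonneg (max (Real.log ‖μ 0‖) 0)
    rw [abs_le] at hj ⊢
    constructor
    · have := le_max_left (x j) 0; linarith [hj.1, hj.2]
    · have : max (x j) 0 ≤ j / (2 * α) + (M + 2 / p / (2 * α)) := by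
        apply max_le <;> linarith [hj.1, hj.2]
      linarith

lemma samp_upper {μ : ℕ → ℂ} {x : ℕ → ℝ} (S : PSeq μ x) {α p M : ℝ} (hα : 0 < α) (hp : 1 < p)
    (hd : ∀ j : ℕ, |x j - (j + 2 / p) / (2 * α)| ≤ M) :
    ∃ C : ℝ, 0 < C ∧ ∀ f, Differentiable ℂ f →
      ∑' j, ENNReal.ofReal (‖f (μ j)‖ * Wt α p (μ j)) ^ p ≤ ENNReal.ofReal C * fockNormP α p f := by
  have hp0 : 0 < p := by linarith
  obtain ⟨D, hD⟩ := S.near hα hp0 hd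
  obtain ⟨C1, hC1, h1⟩ := eval_le (p := p) hα hp0 D
  obtain ⟨C2, hC2, h2⟩ := schur (κ := 1) one_pos hp
  obtain ⟨C3, hC3, h3⟩ := coef_le_fock hα hp
  refine ⟨C1 ^ p * C2 * C3, by positivity, fun f hf => ?_⟩
  obtain ⟨c, hc⟩ := exists_coef hf
  calc ∑' j, ENNReal.ofReal (‖f (μ j)‖ * Wt α p (μ j)) ^ p
      ≤ ∑' j, (ENNReal.ofReal C1 * ∑' k, Kr 1 j k * bet α p c k) ^ p := by
        gcongr with j
        exact h1 c f hc (μ j) j (hD j)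
    _ = ENNReal.ofReal C1 ^ p * ∑' j, (∑' k, Kr 1 j k * bet α p c k) ^ p := by
        rw [← ENNReal.tsum_mul_left]
        simp_rw [ENNReal.mul_rpow_of_nonneg _ _ hp0.le]
    _ ≤ ENNReal.ofReal C1 ^ p * (ENNReal.ofReal C2 * (ENNReal.ofReal C3 * fockNormP α p f)) := by
        gcongr
        exact (h2 _).trans (by gcongr; exact h3 c f hc hf.continuous)
    _ = _ := by
        rw [ENNReal.ofReal_mul (by positivity), ENNReal.ofReal_mul (by positivity),
          ENNReal.ofReal_rpow_of_pos hC1]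
        ring

lemma bdd_of_lp {p : ℝ} (hp : 0 < p) {b : ℕ → ℝ≥0∞} (h : ∑' k, b k ^ p < ⊤) :
    ∃ B : ℝ, 0 ≤ B ∧ ∀ k, b k ≤ ENNReal.ofReal B := by
  set T := (∑' k, b k ^ p) ^ (1 / p) with hT
  have hTt : T ≠ ⊤ := (ENNReal.rpow_lt_top_of_nonneg (by positivity) h.ne).ne
  refine ⟨T.toReal, ENNReal.toReal_nonneg, fun k => ?_⟩
  rw [ENNReal.ofReal_toReal hTt, hT, one_div, ENNReal.le_rpow_inv_iff hp]
  exact ENNReal.le_tsum k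

lemma summable_Kr {κ : ℝ} (hκ : 0 < κ) (k : ℕ) :
    Summable fun m : ℕ => Real.exp (-(κ * |(k : ℝ) - m|)) := by
  obtain ⟨C, hC, h⟩ := Kr_sum_fin hκ
  exact summable_of_sum_le (fun _ => by positivity) (h k)

lemma samp_lower {μ : ℕ → ℂ} {x : ℕ → ℝ} (S : PSeq μ x) {α p M ε K : ℝ} (hα : 0 < α) (hp : 1 < p)
    (hε : 0 < ε)
    (hd : ∀ j : ℕ, |x j - (j + 2 / p) / (2 * α)| ≤ M) (hs : RSep μ x)
    (hc : ∀ m n : ℕ, m ≤ n → |sd α p x n - sd α p x m| ≤ (1 / (4 * α) - ε) * (n - m) + K) :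
    ∃ C : ℝ, 0 < C ∧ ∀ f, MemFock α p f →
      fockNormP α p f ≤ ENNReal.ofReal C * ∑' j, ENNReal.ofReal (‖f (μ j)‖ * Wt α p (μ j)) ^ p := by
  have hp0 : 0 < p := by linarith
  obtain ⟨D, hD⟩ := S.near hα hp0 hd
  obtain ⟨C1, hC1, h1⟩ := lag_bound S hα hp0 hd hs hc
  obtain ⟨C2, hC2, h2⟩ := schur (κ := ε) hε hp
  obtain ⟨C3, hC3, h3⟩ := coef_le_fock hα hp
  obtain ⟨C4, hC4, h4⟩ := fock_upper hα hp
  obtain ⟨C5, hC5, h5⟩ := kernel_upper (p := p) hα hp0 D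
  obtain ⟨C6, hC6, h6⟩ := Kr_sum_fin one_pos
  refine ⟨C4 * (C1 ^ p * C2), by positivity, fun f hf => ?_⟩
  obtain ⟨c, hcf⟩ := exists_coef hf.1
  have hbt : ∑' k, bet α p c k ^ p < ⊤ :=
    (h3 c f hcf hf.1.continuous).trans_lt (ENNReal.mul_lt_top ENNReal.ofReal_lt_top hf.2)
  obtain ⟨B, hB0, hB⟩ := bdd_of_lp hp0 hbt
  have hB' : ∀ k, ‖c k‖ * wk α p k ≤ B := fun k => (ENNReal.ofReal_le_ofReal_iff hB0).1 (hB k)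
  have hw := wk_pos α p
  have hWp := Wt_pos α p
  have key : ∀ k, bet α p c k ≤ ENNReal.ofReal C1 *
      ∑' m, Kr ε k m * ENNReal.ofReal (‖f (μ m)‖ * Wt α p (μ m)) := by
    intro k
    set T : ℕ → ℕ → ℝ := fun N m => if m ≤ N then
      ‖∑ i ∈ Finset.range (N + 1), c i * μ m ^ i‖ * Wt α p (μ m) *
        (C1 * Real.exp (-(ε * |(k : ℝ) - m|))) else 0 with hT
    set T' : ℕ → ℝ := fun m => ‖f (μ m)‖ * Wt α p (μ m) *
        (C1 * Real.exp (-(ε * |(k : ℝ) - m|))) with hT'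
    set U : ℕ → ℝ := fun m => C5 * B * C6 * (C1 * Real.exp (-(ε * |(k : ℝ) - m|))) with hU
    have hUs : Summable U := ((summable_Kr hε k).mul_left C1).mul_left _
    have hlim : ∀ m, Filter.Tendsto (fun N => T N m) Filter.atTop (nhds (T' m)) := by
      intro m
      have a1 : Filter.Tendsto (fun N => ‖∑ i ∈ Finset.range (N + 1), c i * μ m ^ i‖ * Wt α p (μ m) *
        (C1 * Real.exp (-(ε * |(k : ℝ) - m|)))) Filter.atTop (nhds (T' m)) :=
        ((((hcf (μ m)).tendsto_sum_nat).comp (Filter.tendsto_add_atTop_nat 1)).norm.mul_const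
          _).mul_const _
      refine a1.congr' ?_
      filter_upwards [Filter.eventually_ge_atTop m] with N hN
      simp only [hT, if_pos hN]
    have hdom : ∀ N m, ‖T N m‖ ≤ U m := by
      intro N m
      simp only [hT, hU]
      split_ifs with hm
      · rw [Real.norm_of_nonneg (by have := hWp (μ m); positivity)]
        refine mul_le_mul_of_nonneg_right ?_ (by positivity)
        have := hWp (μ m)
        calc ‖∑ i ∈ Finset.range (N + 1), c i * μ m ^ i‖ * Wt α p (μ m)
            ≤ (∑ i ∈ Finset.range (N + 1), ‖c i‖ * ‖μ m‖ ^ i) * Wt α p (μ m) := by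
              gcongr
              refine (norm_sum_le _ _).trans (le_of_eq ?_)
              simp
          _ = ∑ i ∈ Finset.range (N + 1), ‖c i‖ * (‖μ m‖ ^ i * Wt α p (μ m)) := by
              rw [Finset.sum_mul]; simp_rw [mul_assoc]
          _ ≤ ∑ i ∈ Finset.range (N + 1), C5 * B * Real.exp (-(1 * |(m : ℝ) - i|)) := by
              refine Finset.sum_le_sum fun i _ => ?_
              have q1 := h5 (μ m) m i (hD m)
              calc ‖c i‖ * (‖μ m‖ ^ i * Wt α p (μ m))
                  ≤ ‖c i‖ * (C5 * wk α p i * Real.exp (-|(m : ℝ) - i|)) := by gcongr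
                _ = C5 * (‖c i‖ * wk α p i) * Real.exp (-(1 * |(m : ℝ) - i|)) := by
                  rw [one_mul]; ring
                _ ≤ _ := by gcongr; exact hB' i
          _ = C5 * B * ∑ i ∈ Finset.range (N + 1), Real.exp (-(1 * |(m : ℝ) - i|)) := by
              rw [Finset.mul_sum]
          _ ≤ _ := mul_le_mul_of_nonneg_left (h6 m _) (by positivity)
      · rw [norm_zero]; positivity
    have htend := tendsto_tsum_of_dominated_convergence hUs hlim
      (Filter.Eventually.of_forall fun N m => hdom N m)
    have hle : ‖c k‖ * wk α p k ≤ ∑' m, T' m := by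
      refine ge_of_tendsto htend ?_
      filter_upwards [Filter.eventually_ge_atTop k] with N hN
      have hts : ∑' m, T N m = ∑ m ∈ Finset.range (N + 1),
          ‖∑ i ∈ Finset.range (N + 1), c i * μ m ^ i‖ * Wt α p (μ m) *
          (C1 * Real.exp (-(ε * |(k : ℝ) - m|))) := by
        rw [tsum_eq_sum (s := Finset.range (N + 1))]
        · refine Finset.sum_congr rfl fun m hm => ?_
          simp only [hT]; rw [if_pos (by simp at hm; omega)]
        · intro m hm
          simp only [hT]; rw [if_neg (by simp at hm; omega)]
      rw [hts]
      set P : Polynomial ℂ := ∑ i ∈ Finset.range (N + 1), Polynomial.C (c i) * Polynomial.X ^ i with hP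
      have hdeg : P.degree < (Finset.range (N + 1)).card := by
        rw [Finset.card_range]
        refine (Polynomial.degree_sum_le _ _).trans_lt ?_
        rw [Finset.sup_lt_iff (by exact_mod_cast WithBot.bot_lt_coe (N + 1))]
        intro i hi
        refine (Polynomial.degree_C_mul_X_pow_le i (c i)).trans_lt ?_
        have hi' := Finset.mem_range.1 hi
        exact_mod_cast hi'
      have hlagr := Lagrange.eq_interpolate (S.inj.injOn (s := (Finset.range (N + 1) : Set ℕ))) hdeg
      have hck : P.coeff k = c k := by
        rw [hP, Polynomial.finsetSum_coeff]
        simp only [Polynomial.coeff_C_mul_X_pow]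
        rw [Finset.sum_ite_eq]
        rw [if_pos (by simp; omega)]
      have hev : ∀ m, P.eval (μ m) = ∑ i ∈ Finset.range (N + 1), c i * μ m ^ i := by
        intro m; rw [hP, Polynomial.eval_finsetSum]; simp
      rw [← hck, hlagr, Lagrange.interpolate_apply, Polynomial.finsetSum_coeff]
      calc _ ≤ (∑ m ∈ Finset.range (N + 1), ‖(Polynomial.C (P.eval (μ m)) *
              Lagrange.basis (Finset.range (N + 1)) μ m).coeff k‖) * wk α p k := by
            have := hw k
            gcongr; exact norm_sum_le _ _
        _ ≤ _ := by
            rw [Finset.sum_mul]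
            refine Finset.sum_le_sum fun m hm => ?_
            rw [Polynomial.coeff_C_mul, norm_mul, hev m, mul_assoc, mul_assoc]
            refine mul_le_mul_of_nonneg_left ?_ (norm_nonneg _)
            rw [mul_comm (Wt α p (μ m))]
            exact h1 N m k (by simp at hm; omega) hN
    have hT's : Summable T' := by
      refine Summable.of_nonneg_of_le (fun m => by have := hWp (μ m); positivity) (fun m => ?_) hUs
      refine le_of_tendsto (hlim m) (Filter.Eventually.of_forall fun N => ?_)
      exact (le_abs_self _).trans (hdom N m)
    calc bet α p c k ≤ ENNReal.ofReal (∑' m, T' m) := ENNReal.ofReal_le_ofReal hle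
      _ = ∑' m, ENNReal.ofReal (T' m) :=
        ENNReal.ofReal_tsum_of_nonneg (fun m => by have := hWp (μ m); positivity) hT's
      _ = _ := by
        rw [← ENNReal.tsum_mul_left]
        refine tsum_congr fun m => ?_
        have := hWp (μ m)
        simp only [hT', Kr]
        rw [← ENNReal.ofReal_mul (by positivity), ← ENNReal.ofReal_mul (by positivity)]
        congr 1; ring
  calc fockNormP α p f ≤ ENNReal.ofReal C4 * ∑' k, bet α p c k ^ p := h4 c f hcf
    _ ≤ ENNReal.ofReal C4 * ∑' k, (ENNReal.ofReal C1 *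
      ∑' m, Kr ε k m * ENNReal.ofReal (‖f (μ m)‖ * Wt α p (μ m))) ^ p := by
        gcongr with k; exact key k
    _ = ENNReal.ofReal C4 * (ENNReal.ofReal C1 ^ p *
      ∑' k, (∑' m, Kr ε k m * ENNReal.ofReal (‖f (μ m)‖ * Wt α p (μ m))) ^ p) := by
        congr 1
        rw [← ENNReal.tsum_mul_left]
        simp_rw [ENNReal.mul_rpow_of_nonneg _ _ hp0.le]
    _ ≤ ENNReal.ofReal C4 * (ENNReal.ofReal C1 ^ p * (ENNReal.ofReal C2 *
      ∑' m, ENNReal.ofReal (‖f (μ m)‖ * Wt α p (μ m)) ^ p)) := by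
        gcongr; exact h2 _
    _ = _ := by
        rw [ENNReal.ofReal_mul (by positivity), ENNReal.ofReal_mul (by positivity),
          ENNReal.ofReal_rpow_of_pos hC1]
        ring

/-- a power series with coefficients of bounded weighted size is entire -/
lemma entire_of_bdd {α p B : ℝ} (hα : 0 < α) (hp : 0 < p) (z : ℂ) : ∃ u : ℕ → ℝ, Summable u ∧
    ∀ (c : ℕ → ℂ), (∀ k, ‖c k‖ * wk α p k ≤ B) → ∀ w : ℂ, ‖w‖ ≤ ‖z‖ → ∀ k, ‖c k * w ^ k‖ ≤ u k := by
  obtain ⟨n, -, -, hn⟩ := floor_logPlus hα z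
  obtain ⟨C5, hC5, h5⟩ := kernel_upper (p := p) hα hp (1 / (2 * α))
  have hW := Wt_pos α p z
  refine ⟨fun k => (Wt α p z)⁻¹ * C5 * B * Real.exp (-(1 * |(n : ℝ) - k|)),
    (summable_Kr one_pos n).mul_left _, fun c hc w hw k => ?_⟩
  have hwk := wk_pos α p k
  rw [norm_mul, norm_pow]
  have h6 := h5 z n k hn
  simp only [one_mul]
  have h7 : ‖z‖ ^ k ≤ (Wt α p z)⁻¹ * (C5 * wk α p k * Real.exp (-|(n : ℝ) - k|)) := by
    rw [inv_mul_eq_div, le_div_iff₀ hW]; exact h6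
  calc ‖c k‖ * ‖w‖ ^ k ≤ ‖c k‖ * ((Wt α p z)⁻¹ * (C5 * wk α p k * Real.exp (-|(n : ℝ) - k|))) := by
        refine mul_le_mul_of_nonneg_left (le_trans ?_ h7) (norm_nonneg _)
        gcongr
    _ = (Wt α p z)⁻¹ * C5 * (‖c k‖ * wk α p k) * Real.exp (-|(n : ℝ) - k|) := by ring
    _ ≤ _ := by gcongr; exact hc k

lemma interp {μ : ℕ → ℂ} {x : ℕ → ℝ} (S : PSeq μ x) {α p M ε K : ℝ} (hα : 0 < α) (hp : 1 < p)
    (hε : 0 < ε)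
    (hd : ∀ j : ℕ, |x j - (j + 2 / p) / (2 * α)| ≤ M) (hs : RSep μ x)
    (hc : ∀ m n : ℕ, m ≤ n → |sd α p x n - sd α p x m| ≤ (1 / (4 * α) - ε) * (n - m) + K)
    (v : ℕ → ℂ) (hv : ∑' j, ENNReal.ofReal (‖v j‖ * Wt α p (μ j)) ^ p < ⊤) :
    ∃ f, MemFock α p f ∧ ∀ j, f (μ j) = v j := by
  have hp0 : 0 < p := by linarith
  obtain ⟨C1, hC1, h1⟩ := lag_bound S hα hp0 hd hs hc
  obtain ⟨C2, hC2, h2⟩ := schur (κ := ε) hε hp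
  obtain ⟨C4, hC4, h4⟩ := fock_upper hα hp
  obtain ⟨C6, hC6, h6⟩ := Kr_sum_fin hε
  obtain ⟨B, hB0, hB⟩ := bdd_of_lp hp0 hv
  have hw := wk_pos α p
  have hWp := Wt_pos α p
  set u : ℕ → ℝ := fun j => ‖v j‖ * Wt α p (μ j) with hu
  have hu0 : ∀ j, 0 ≤ u j := fun j => by have := hWp (μ j); positivity
  have hB' : ∀ j, u j ≤ B := fun k => (ENNReal.ofReal_le_ofReal_iff hB0).1 (hB k)
  set b : ℕ → ℝ := fun k => ∑' m : ℕ, C1 * (Real.exp (-(ε * |(k : ℝ) - (m : ℕ)|)) * u m) with hb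
  have hsum : ∀ k : ℕ, Summable fun m : ℕ => C1 * (Real.exp (-(ε * |(k : ℝ) - (m : ℕ)|)) * u m) := by
    intro k
    refine Summable.mul_left _ (Summable.of_nonneg_of_le (fun m => mul_nonneg (by positivity) (hu0 m))
      (fun m => ?_) ((summable_Kr hε k).mul_right B))
    gcongr; exact hB' m
  set q : ℕ → ℕ → ℂ := fun N k =>
    (Lagrange.interpolate (Finset.range (N + 1)) μ v).coeff k with hq
  have hqb : ∀ N k, ‖q N k‖ * wk α p k ≤ b k := by
    intro N k
    have hb0 : 0 ≤ b k := tsum_nonneg fun m => mul_nonneg hC1.le (mul_nonneg (by positivity) (hu0 m))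
    by_cases hk : k ≤ N
    · simp only [hq]
      rw [Lagrange.interpolate_apply, Polynomial.finsetSum_coeff]
      calc _ ≤ (∑ m ∈ Finset.range (N + 1), ‖(Polynomial.C (v m) *
              Lagrange.basis (Finset.range (N + 1)) μ m).coeff k‖) * wk α p k := by
            have := hw k
            gcongr; exact norm_sum_le _ _
        _ ≤ ∑ m ∈ Finset.range (N + 1), C1 * (Real.exp (-(ε * |(k : ℝ) - (m : ℕ)|)) * u m) := by
            rw [Finset.sum_mul]
            refine Finset.sum_le_sum fun m hm => ?_
            rw [Polynomial.coeff_C_mul, norm_mul, mul_assoc]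
            have := h1 N m k (by simp at hm; omega) hk
            refine (mul_le_mul_of_nonneg_left this (norm_nonneg _)).trans (le_of_eq ?_)
            simp only [hu]; ring
        _ ≤ b k := (hsum k).sum_le_tsum _ fun m _ => mul_nonneg hC1.le (mul_nonneg (by positivity) (hu0 m))
    · have : q N k = 0 := by
        simp only [hq]
        apply Polynomial.coeff_eq_zero_of_degree_lt
        refine (Lagrange.degree_interpolate_lt v (S.inj.injOn)).trans_le ?_
        rw [Finset.card_range]
        exact_mod_cast (by omega : N + 1 ≤ k)
      rw [this, norm_zero, zero_mul]; exact hb0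
  have hbB : ∀ k, b k ≤ C1 * (C6 * B) := by
    intro k
    simp only [hb]
    rw [tsum_mul_left]
    refine mul_le_mul_of_nonneg_left ?_ hC1.le
    refine Real.tsum_le_of_sum_le (fun m => mul_nonneg (by positivity) (hu0 m)) fun F => ?_
    refine le_trans ?_ (mul_le_mul_of_nonneg_right (h6 k F) hB0)
    rw [Finset.sum_mul]
    refine Finset.sum_le_sum fun m _ => ?_
    gcongr; exact hB' m
  let 𝓤 : Ultrafilter ℕ := Filter.hyperfilter ℕ
  have hlim : ∀ k, ∃ c : ℂ, Filter.Tendsto (fun N => q N k) 𝓤 (nhds c) := by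
    intro k
    have hcomp : IsCompact (Metric.closedBall (0 : ℂ) (b k / wk α p k)) := isCompact_closedBall _ _
    have hmem : ∀ N, q N k ∈ Metric.closedBall (0 : ℂ) (b k / wk α p k) := by
      intro N
      rw [mem_closedBall_zero_iff, le_div_iff₀ (hw k)]; exact hqb N k
    obtain ⟨c, -, hc⟩ := hcomp.ultrafilter_le_nhds (𝓤.map fun N => q N k)
      (by rw [Filter.le_principal_iff]; exact Filter.mem_map.2 (Filter.univ_mem' hmem))
    exact ⟨c, hc⟩
  choose c hcl using hlim
  have hcb : ∀ k, ‖c k‖ * wk α p k ≤ b k := fun k =>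
    le_of_tendsto ((hcl k).norm.mul_const _) (Filter.Eventually.of_forall fun N => hqb N k)
  have hcB : ∀ k, ‖c k‖ * wk α p k ≤ C1 * (C6 * B) := fun k => (hcb k).trans (hbB k)
  have hqB : ∀ N k, ‖q N k‖ * wk α p k ≤ C1 * (C6 * B) := fun N k => (hqb N k).trans (hbB k)
  have hcoef : Coef c (fun z => ∑' k, c k * z ^ k) := by
    intro z
    obtain ⟨U, hU, hUb⟩ := entire_of_bdd (B := C1 * (C6 * B)) hα hp0 z
    exact (Summable.of_norm_bounded hU fun k => hUb c hcB z le_rfl k).hasSum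
  refine ⟨fun z => ∑' k, c k * z ^ k, ⟨?_, ?_⟩, fun j => ?_⟩
  · intro z
    obtain ⟨U, hU, hUb⟩ := entire_of_bdd (B := C1 * (C6 * B)) hα hp0 ((‖z‖ + 1 : ℝ) : ℂ)
    have e : ‖((‖z‖ + 1 : ℝ) : ℂ)‖ = ‖z‖ + 1 := by
      rw [Complex.norm_real, Real.norm_of_nonneg (by positivity)]
    rw [e] at hUb
    have := Complex.differentiableOn_tsum_of_summable_norm (F := fun k z => c k * z ^ k)
      (U := Metric.ball 0 (‖z‖ + 1)) hU (fun k => by fun_prop) Metric.isOpen_ball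
      (fun k w hw => hUb c hcB w (by rw [mem_ball_zero_iff] at hw; exact hw.le) k)
    exact this.differentiableAt (Metric.isOpen_ball.mem_nhds (by simp))
  · refine (h4 c _ hcoef).trans_lt (ENNReal.mul_lt_top ENNReal.ofReal_lt_top ?_)
    calc ∑' k, bet α p c k ^ p
        ≤ ∑' k, (ENNReal.ofReal C1 * ∑' m, Kr ε k m * ENNReal.ofReal (u m)) ^ p := by
          gcongr with k
          calc bet α p c k ≤ ENNReal.ofReal (b k) := ENNReal.ofReal_le_ofReal (hcb k)
            _ = ∑' m : ℕ, ENNReal.ofReal (C1 * (Real.exp (-(ε * |(k : ℝ) - (m : ℕ)|)) * u m)) :=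
              ENNReal.ofReal_tsum_of_nonneg
                (fun m => mul_nonneg hC1.le (mul_nonneg (by positivity) (hu0 m))) (hsum k)
            _ = _ := by
              rw [← ENNReal.tsum_mul_left]
              refine tsum_congr fun m => ?_
              rw [ENNReal.ofReal_mul hC1.le, ENNReal.ofReal_mul (by positivity)]; rfl
      _ = ENNReal.ofReal C1 ^ p * ∑' k, (∑' m, Kr ε k m * ENNReal.ofReal (u m)) ^ p := by
          rw [← ENNReal.tsum_mul_left]
          simp_rw [ENNReal.mul_rpow_of_nonneg _ _ hp0.le]
      _ ≤ ENNReal.ofReal C1 ^ p * (ENNReal.ofReal C2 * ∑' m, ENNReal.ofReal (u m) ^ p) := by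
          gcongr; exact h2 _
      _ < ⊤ := by
          refine ENNReal.mul_lt_top (ENNReal.rpow_lt_top_of_nonneg hp0.le ENNReal.ofReal_ne_top)
            (ENNReal.mul_lt_top ENNReal.ofReal_lt_top hv)
  · obtain ⟨U, hU, hUb⟩ := entire_of_bdd (B := C1 * (C6 * B)) hα hp0 (μ j)
    have ht : Filter.Tendsto (fun N => ∑' k, q N k * μ j ^ k) 𝓤 (nhds (∑' k, c k * μ j ^ k)) :=
      tendsto_tsum_of_dominated_convergence hU (fun k => (hcl k).mul_const _)
        (Filter.Eventually.of_forall fun N k => hUb (q N) (hqB N) (μ j) le_rfl k)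
    have hev : ∀ᶠ N in (𝓤 : Filter ℕ), ∑' k, q N k * μ j ^ k = v j := by
      have hle : (𝓤 : Filter ℕ) ≤ Filter.atTop := by
        rw [← Nat.cofinite_eq_atTop]; exact Filter.hyperfilter_le_cofinite
      filter_upwards [hle (Filter.eventually_ge_atTop j)] with N hN
      have e1 := Lagrange.eval_interpolate_at_node v
        (S.inj.injOn (s := (Finset.range (N + 1) : Set ℕ))) (i := j) (by simp; omega)
      rw [← e1, Polynomial.eval_eq_sum, Polynomial.sum_def]
      rw [tsum_eq_sum]
      intro k hk
      simp only [hq]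
      rw [Polynomial.notMem_support_iff.1 hk, zero_mul]
    exact tendsto_nhds_unique (ht.congr' hev) tendsto_const_nhds

theorem suff {μ : ℕ → ℂ} {x : ℕ → ℝ} (S : PSeq μ x) {α p M ε K : ℝ} (hα : 0 < α) (hp : 1 < p)
    (hε : 0 < ε)
    (hd : ∀ j : ℕ, |x j - (j + 2 / p) / (2 * α)| ≤ M) (hs : RSep μ x)
    (hc : ∀ m n : ℕ, m ≤ n → |sd α p x n - sd α p x m| ≤ (1 / (4 * α) - ε) * (n - m) + K) :
    CompleteInterpolating α p (Set.range μ) := by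
  have hp0 : 0 < p := by linarith
  obtain ⟨C1, hC1, h1⟩ := samp_upper S hα hp hd
  obtain ⟨C2, hC2, h2⟩ := samp_lower S hα hp hε hd hs hc
  constructor
  · refine ⟨max 1 (max C1 C2), le_max_left _ _, fun f hf => ?_⟩
    have hpos : 0 < max 1 (max C1 C2) := by positivity
    unfold discNormP
    rw [disc_eq S.inj hp0]
    constructor
    · rw [mul_comm, ← div_eq_mul_inv]
      refine ENNReal.div_le_of_le_mul' ((h2 f hf).trans ?_)
      gcongr
      exact (le_max_right _ _).trans (le_max_right _ _)
    · refine (h1 f hf.1).trans ?_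
      gcongr
      exact (le_max_left _ _).trans (le_max_right _ _)
  · intro v hv
    rw [disc_eq S.inj hp0] at hv
    obtain ⟨f, hf, h⟩ := interp S hα hp hε hd hs hc (fun j => v (μ j)) hv
    refine ⟨f, hf, ?_⟩
    rintro _ ⟨j, rfl⟩
    exact h j

lemma max_mod {g : ℂ → ℂ} (hg : Differentiable ℂ g) {R : ℝ} (hR : 0 < R) {w : ℂ} (hw : ‖w‖ ≤ R) :
    ∃ z : ℂ, ‖z‖ = R ∧ ‖g w‖ ≤ ‖g z‖ := by
  obtain ⟨z, hz, hmax⟩ := Complex.exists_mem_frontier_isMaxOn_norm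
    (Metric.isBounded_ball (x := (0 : ℂ)) (r := R)) ⟨0, by simpa using hR⟩
    (hg.diffContOnCl)
  rw [frontier_ball _ hR.ne', mem_sphere_zero_iff_norm] at hz
  refine ⟨z, hz, ?_⟩
  rw [closure_ball _ hR.ne'] at hmax
  exact hmax (mem_closedBall_zero_iff.2 hw)

lemma factor_zeros {μ : ℕ → ℂ} (hμ : Function.Injective μ) (F : Finset ℕ) :
    ∀ f : ℂ → ℂ, Differentiable ℂ f → (∀ j ∈ F, f (μ j) = 0) →
    ∃ g : ℂ → ℂ, Differentiable ℂ g ∧ ∀ z, f z = g z * ∏ j ∈ F, (z - μ j) := by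
  induction F using Finset.induction_on with
  | empty => intro f hf _; exact ⟨f, hf, by simp⟩
  | insert i F hi ih =>
    intro f hf h0
    have hfi : f (μ i) = 0 := h0 i (Finset.mem_insert_self _ _)
    have e : ∀ z, f z = (z - μ i) * dslope f (μ i) z := by
      intro z
      have := sub_smul_dslope f (μ i) z
      rw [hfi, sub_zero, smul_eq_mul] at this
      exact this.symm
    have hds : Differentiable ℂ (dslope f (μ i)) := by
      have := (Complex.differentiableOn_dslope (c := μ i) (s := Set.univ) Filter.univ_mem).2
        hf.differentiableOn
      exact differentiableOn_univ.1 this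
    obtain ⟨g, hg, hgz⟩ := ih (dslope f (μ i)) hds (by
      intro j hj
      have h1 := h0 j (Finset.mem_insert_of_mem hj)
      rw [e] at h1
      have hne : μ j - μ i ≠ 0 := by
        rw [sub_ne_zero]; intro h; exact hi (hμ h ▸ hj)
      exact (mul_eq_zero.1 h1).resolve_left hne)
    refine ⟨g, hg, fun z => ?_⟩
    rw [e, hgz, Finset.prod_insert hi]; ring

lemma zeros_bound {μ : ℕ → ℂ} (hμ : Function.Injective μ) (F : Finset ℕ) {f : ℂ → ℂ}
    (hf : Differentiable ℂ f) (h0 : ∀ j ∈ F, f (μ j) = 0) {R : ℝ} (hR : 0 < R)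
    (hF : ∀ j ∈ F, ‖μ j‖ ≤ R) {w : ℂ} (hw : ‖w‖ ≤ R) :
    ∃ z : ℂ, ‖z‖ = R ∧ ‖f w‖ * ∏ j ∈ F, (R - ‖μ j‖) ≤ ‖f z‖ * ∏ j ∈ F, ‖w - μ j‖ := by
  obtain ⟨g, hg, hgz⟩ := factor_zeros hμ F f hf h0
  obtain ⟨z, hz, hle⟩ := max_mod hg hR hw
  refine ⟨z, hz, ?_⟩
  rw [hgz, hgz, norm_mul, norm_mul, norm_prod, norm_prod]
  have h1 : ∏ j ∈ F, (R - ‖μ j‖) ≤ ∏ j ∈ F, ‖z - μ j‖ := by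
    refine Finset.prod_le_prod (fun j hj => sub_nonneg.2 (hF j hj)) fun j _ => ?_
    rw [← hz]; exact norm_sub_norm_le _ _
  have h2 : 0 ≤ ∏ j ∈ F, (R - ‖μ j‖) := Finset.prod_nonneg fun j hj => sub_nonneg.2 (hF j hj)
  have h3 : 0 ≤ ∏ j ∈ F, ‖w - μ j‖ := by positivity
  calc ‖g w‖ * (∏ j ∈ F, ‖w - μ j‖) * ∏ j ∈ F, (R - ‖μ j‖)
      ≤ ‖g z‖ * (∏ j ∈ F, ‖w - μ j‖) * ∏ j ∈ F, ‖z - μ j‖ := by gcongr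
    _ = _ := by ring

lemma jensen_lower (μ : ℕ → ℂ) (F : Finset ℕ) {r : ℝ} (hr : 0 < r) :
    ∃ z : ℂ, ‖z‖ = r ∧ ∏ j ∈ F, max r ‖μ j‖ ≤ ∏ j ∈ F, ‖z - μ j‖ := by
  set q : ℕ → ℂ → ℂ := fun j z => if r ≤ ‖μ j‖ then z - μ j else
    r - (starRingEnd ℂ) (μ j) * z / r with hq
  have hqd : ∀ j, Differentiable ℂ (q j) := by
    intro j
    simp only [hq]
    split_ifs
    · fun_prop
    · fun_prop
  have hr' : (r : ℂ) ≠ 0 := by exact_mod_cast hr.ne'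
  have hq1 : ∀ j z, ‖z‖ = r → ‖q j z‖ = ‖z - μ j‖ := by
    intro j z hz
    simp only [hq]
    split_ifs
    · rfl
    · have e : (r : ℂ) - (starRingEnd ℂ) (μ j) * z / r =
          z * (starRingEnd ℂ) (z - μ j) / r := by
        have : z * (starRingEnd ℂ) z = (r : ℂ) ^ 2 := by
          rw [Complex.mul_conj, Complex.normSq_eq_norm_sq, hz]; push_cast; rfl
        rw [map_sub, mul_sub, this]
        field_simp
      rw [e, norm_div, norm_mul, RCLike.norm_conj, hz, Complex.norm_real,
        Real.norm_of_nonneg hr.le]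
      field_simp
  have hq0 : ∀ j, ‖q j 0‖ = max r ‖μ j‖ := by
    intro j
    simp only [hq]
    split_ifs with h
    · rw [max_eq_right h]; simp
    · rw [max_eq_left (le_of_not_ge h)]; simp [abs_of_pos hr]
  obtain ⟨z, hz, hle⟩ := max_mod (g := fun z => ∏ j ∈ F, q j z)
    (by fun_prop (disch := exact hqd _)) hr (w := 0) (by simpa using hr.le)
  refine ⟨z, hz, ?_⟩
  simp only [norm_prod] at hle
  calc _ = ∏ j ∈ F, ‖q j 0‖ := Finset.prod_congr rfl fun j _ => (hq0 j).symm
    _ ≤ _ := hle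
    _ = _ := Finset.prod_congr rfl fun j _ => hq1 j z hz

lemma disc_decay {t : ℕ → ℝ} {C : ℝ} (hC : 1 < C) (ht : ∀ n, 0 < t n)
    (h : ∀ m M, m < M → ∑ n ∈ Finset.Ico m M, t n ≤ C * t m) (m k : ℕ) :
    t (m + k) ≤ C * (1 - C⁻¹) ^ k * t m := by
  have hC0 : 0 < C := by linarith
  have hρ : 0 ≤ 1 - C⁻¹ := by
    have := inv_le_one_of_one_le₀ hC.le; linarith
  have step : ∀ j M, ∑ n ∈ Finset.Ico (j + 1) M, t n ≤ (1 - C⁻¹) * ∑ n ∈ Finset.Ico j M, t n := by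
    intro j M
    by_cases hj : j < M
    · have h1 := h j M hj
      have h2 := Finset.sum_eq_sum_Ico_succ_bot hj t
      have h3 : C⁻¹ * ∑ n ∈ Finset.Ico j M, t n ≤ t j := by
        rw [inv_mul_le_iff₀ hC0]; exact h1
      linarith
    · rw [Finset.Ico_eq_empty (by omega), Finset.Ico_eq_empty (by omega)]; simp
  have ind : ∀ k M, ∑ n ∈ Finset.Ico (m + k) M, t n ≤ (1 - C⁻¹) ^ k * ∑ n ∈ Finset.Ico m M, t n := by
    intro k M
    induction k with
    | zero => simp
    | succ k ih =>
      refine (step (m + k) M).trans ?_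
      rw [pow_succ']
      rw [mul_assoc]
      exact mul_le_mul_of_nonneg_left ih hρ
  have h1 := ind k (m + k + 1)
  rw [Nat.Ico_succ_singleton, Finset.sum_singleton] at h1
  refine h1.trans ?_
  have h2 := mul_le_mul_of_nonneg_left (h m (m + k + 1) (by omega)) (pow_nonneg hρ k)
  linarith

lemma disc_growth {t : ℕ → ℝ} {C : ℝ} (hC : 1 < C) (ht : ∀ n, 0 < t n)
    (h : ∀ m n, m ≤ n → ∑ i ∈ Finset.Ico m (n + 1), t i ≤ C * t n) (m k : ℕ) :
    t m ≤ C * (1 - C⁻¹) ^ k * t (m + k) := by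
  have hC0 : 0 < C := by linarith
  have hρ : 0 ≤ 1 - C⁻¹ := by
    have := inv_le_one_of_one_le₀ hC.le; linarith
  have ind : ∀ k, t m ≤ (1 - C⁻¹) ^ k * ∑ n ∈ Finset.Ico m (m + k + 1), t n := by
    intro k
    induction k with
    | zero => simp
    | succ k ih =>
      refine ih.trans ?_
      rw [pow_succ, mul_assoc]
      refine mul_le_mul_of_nonneg_left ?_ (pow_nonneg hρ k)
      have h1 := h m (m + k + 1) (by omega)
      have h2 := Finset.sum_Ico_succ_top (show m ≤ m + k + 1 by omega) t
      have h3 : C⁻¹ * ∑ n ∈ Finset.Ico m (m + k + 1 + 1), t n ≤ t (m + k + 1) := by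
        rw [inv_mul_le_iff₀ hC0]; exact h1
      rw [show m + (k + 1) + 1 = m + k + 1 + 1 by ring]
      linarith
  refine (ind k).trans ?_
  have h2 := mul_le_mul_of_nonneg_left (h m (m + k) (by omega)) (pow_nonneg hρ k)
  linarith

lemma eval_sum {α p : ℝ} (hα : 0 < α) (hp : 1 < p) (D : ℝ) :
    ∃ C : ℝ, 0 < C ∧ ∀ f, Differentiable ℂ f → ∀ z : ℕ → ℂ,
      (∀ j : ℕ, |logPlus ‖z j‖ - j / (2 * α)| ≤ D) →
      ∑' j, ENNReal.ofReal (‖f (z j)‖ * Wt α p (z j)) ^ p ≤ ENNReal.ofReal C * fockNormP α p f := by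
  have hp0 : 0 < p := by linarith
  obtain ⟨C1, hC1, h1⟩ := eval_le (p := p) hα hp0 D
  obtain ⟨C2, hC2, h2⟩ := schur (κ := 1) one_pos hp
  obtain ⟨C3, hC3, h3⟩ := coef_le_fock hα hp
  refine ⟨C1 ^ p * C2 * C3, by positivity, fun f hf z hz => ?_⟩
  obtain ⟨c, hc⟩ := exists_coef hf
  calc ∑' j, ENNReal.ofReal (‖f (z j)‖ * Wt α p (z j)) ^ p
      ≤ ∑' j, (ENNReal.ofReal C1 * ∑' k, Kr 1 j k * bet α p c k) ^ p := by
        gcongr with j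
        exact h1 c f hc (z j) j (hz j)
    _ = ENNReal.ofReal C1 ^ p * ∑' j, (∑' k, Kr 1 j k * bet α p c k) ^ p := by
        rw [← ENNReal.tsum_mul_left]
        simp_rw [ENNReal.mul_rpow_of_nonneg _ _ hp0.le]
    _ ≤ ENNReal.ofReal C1 ^ p * (ENNReal.ofReal C2 * (ENNReal.ofReal C3 * fockNormP α p f)) := by
        gcongr
        exact (h2 _).trans (by gcongr; exact h3 c f hc hf.continuous)
    _ = _ := by
        rw [ENNReal.ofReal_mul (by positivity), ENNReal.ofReal_mul (by positivity),
          ENNReal.ofReal_rpow_of_pos hC1]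
        ring

lemma near_exp {α ξ D : ℝ} (hα : 0 < α) {z : ℂ} (hz : ‖z‖ = Real.exp ξ) (n : ℕ)
    (h : |ξ - n / (2 * α)| ≤ D) : |logPlus ‖z‖ - n / (2 * α)| ≤ D := by
  unfold logPlus
  rw [hz, Real.log_exp]
  have hpos : 0 ≤ (n : ℝ) / (2 * α) := by positivity
  have hD := (abs_nonneg _).trans h
  rw [abs_le] at h ⊢
  constructor
  · have := le_max_left ξ 0; linarith [h.1]
  · have : max ξ 0 ≤ n / (2 * α) + D := by apply max_le <;> linarith [h.2]
    linarith

lemma exists_near {α : ℝ} (hα : 0 < α) (n : ℕ) :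
    |logPlus ‖((Real.exp (n / (2 * α)) : ℝ) : ℂ)‖ - n / (2 * α)| ≤ 0 := by
  apply near_exp hα (ξ := n / (2 * α))
  · rw [Complex.norm_real, Real.norm_of_nonneg (by positivity)]
  · simp

lemma eval_point {α p : ℝ} (hα : 0 < α) (hp : 1 < p) :
    ∃ C : ℝ, 0 < C ∧ ∀ f, Differentiable ℂ f → ∀ z : ℂ,
      ENNReal.ofReal (‖f z‖ * Wt α p z) ^ p ≤ ENNReal.ofReal C * fockNormP α p f := by
  obtain ⟨C, hC, h⟩ := eval_sum hα hp (1 / (2 * α))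
  refine ⟨C, hC, fun f hf z => ?_⟩
  obtain ⟨n, -, -, hn⟩ := floor_logPlus hα z
  set Z : ℕ → ℂ := Function.update (fun j : ℕ => ((Real.exp (j / (2 * α)) : ℝ) : ℂ)) n z with hZ
  have := h f hf Z (by
    intro j
    by_cases hj : j = n
    · subst hj; simp only [hZ, Function.update_self]; exact hn
    · simp only [hZ, Function.update_of_ne hj]
      exact (exists_near hα j).trans (by positivity))
  refine le_trans ?_ this
  have h2 := ENNReal.le_tsum (f := fun j => ENNReal.ofReal (‖f (Z j)‖ * Wt α p (Z j)) ^ p) n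
  simpa [hZ] using h2

lemma poly_coef (P : Polynomial ℂ) : Coef (fun k => P.coeff k) (fun z => P.eval z) := by
  intro z
  show HasSum (fun k => P.coeff k * z ^ k) (P.eval z)
  rw [Polynomial.eval_eq_sum, Polynomial.sum_def]
  apply hasSum_sum_of_ne_finset_zero
  intro k hk
  rw [Polynomial.notMem_support_iff.1 hk, zero_mul]

lemma poly_mem {α p : ℝ} (hα : 0 < α) (hp : 1 < p) (P : Polynomial ℂ) :
    MemFock α p (fun z => P.eval z) := by
  have hp0 : 0 < p := by linarith
  obtain ⟨C, hC, h⟩ := fock_upper hα hp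
  refine ⟨P.differentiable, (h _ _ (poly_coef P)).trans_lt (ENNReal.mul_lt_top ENNReal.ofReal_lt_top ?_)⟩
  rw [tsum_eq_sum (s := P.support)]
  · rw [ENNReal.sum_lt_top]
    intro k _
    exact ENNReal.rpow_lt_top_of_nonneg hp0.le ENNReal.ofReal_ne_top
  · intro k hk
    show ENNReal.ofReal (‖P.coeff k‖ * wk α p k) ^ p = 0
    rw [Polynomial.notMem_support_iff.1 hk]
    simp [hp0]

lemma nec_dens {μ : ℕ → ℂ} {x : ℕ → ℝ} (S : PSeq μ x) {α p A : ℝ} (hα : 0 < α) (hp : 1 < p)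
    (hA : 0 < A)
    (hU : ∀ f, MemFock α p f → ∑' j, ENNReal.ofReal (‖f (μ j)‖ * Wt α p (μ j)) ^ p ≤
      ENNReal.ofReal A * fockNormP α p f) : Dens x := by
  have hp0 : 0 < p := by linarith
  have hp2 : 0 < 2 / p := by positivity
  obtain ⟨C, hC, hfock⟩ := fock_upper hα hp
  obtain ⟨c, hc, hker⟩ := kernel_lower (p := p) hα hp0 (-(x 0))
  set y : ℕ → ℝ := fun k => (k + 2 / p) / (2 * α) with hy
  -- Step A
  have stepA : ∀ (k : ℕ) (F : Finset ℕ), (∀ j ∈ F, 1 ≤ j) →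
      ∑ j ∈ F, Real.exp (-(p * (α * (x j - y k) ^ 2))) ≤ A * C * (c⁻¹) ^ p := by
    intro k F hF
    have hwk := wk_pos α p k
    have hmem := poly_mem hα hp (Polynomial.X ^ k : Polynomial ℂ)
    have h1 := hU _ hmem
    have h2 := hfock _ _ (poly_coef (Polynomial.X ^ k : Polynomial ℂ))
    have h3 : ∑' i, bet α p (fun i => (Polynomial.X ^ k : Polynomial ℂ).coeff i) i ^ p
        = ENNReal.ofReal (wk α p k) ^ p := by
      rw [tsum_eq_single k]
      · simp [bet]
      · intro i hi
        simp [bet, Polynomial.coeff_X_pow, hi, hp0]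
    rw [h3] at h2
    have h4 : ∑ j ∈ F, ENNReal.ofReal (c * wk α p k * Real.exp (-(α * (x j - y k) ^ 2))) ^ p ≤
        ENNReal.ofReal A * (ENNReal.ofReal C * ENNReal.ofReal (wk α p k) ^ p) := by
      refine le_trans ?_ ((ENNReal.sum_le_tsum F).trans (h1.trans (mul_le_mul' le_rfl h2)))
      refine Finset.sum_le_sum fun j hj => ?_
      refine ENNReal.rpow_le_rpow (ENNReal.ofReal_le_ofReal ?_) hp0.le
      have hj1 := S.h1 j (hF j hj)
      have := hker (μ j) k (by rw [← norm_pos_iff, hj1]; exact Real.exp_pos _)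
        (by rw [hj1, Real.log_exp, neg_neg]; exact S.mono (Nat.zero_le j))
      rw [hj1, Real.log_exp] at this
      simp only [Polynomial.eval_pow, Polynomial.eval_X, norm_pow, hj1]
      exact this
    have h5 : ∑ j ∈ F, ENNReal.ofReal (c * wk α p k * Real.exp (-(α * (x j - y k) ^ 2))) ^ p =
        ENNReal.ofReal ((c * wk α p k) ^ p * ∑ j ∈ F, Real.exp (-(p * (α * (x j - y k) ^ 2)))) := by
      rw [Finset.mul_sum, ENNReal.ofReal_sum_of_nonneg (fun _ _ => by positivity)]
      refine Finset.sum_congr rfl fun j _ => ?_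
      rw [ENNReal.ofReal_rpow_of_nonneg (by positivity) hp0.le, Real.mul_rpow (by positivity)
        (by positivity), ← Real.exp_mul]
      congr 3; ring
    rw [h5, ENNReal.ofReal_rpow_of_pos hwk, ← ENNReal.ofReal_mul hC.le, ← ENNReal.ofReal_mul hA.le,
      ENNReal.ofReal_le_ofReal_iff (by positivity), Real.mul_rpow hc.le hwk.le] at h4
    rw [Real.inv_rpow hc.le, ← div_eq_mul_inv, le_div_iff₀ (by positivity)]
    have hwp : 0 < wk α p k ^ p := by positivity
    refine le_of_mul_le_mul_right ?_ hwp
    linarith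
  -- nearest indices
  set D : ℝ := |x 0| + 2 / p / (2 * α) + 1 / (2 * α) with hD
  have hD0 : 0 < D := by positivity
  have near : ∀ j : ℕ, ∃ k : ℕ, |x j - y k| ≤ D := by
    intro j
    by_cases h : x j ≤ 2 / p / (2 * α)
    · refine ⟨0, ?_⟩
      have h0 := S.mono (Nat.zero_le j)
      have h1 := neg_abs_le (x 0)
      have h2 : 0 < 1 / (2 * α) := by positivity
      have h3 : 0 < 2 / p / (2 * α) := by positivity
      have h4 := abs_nonneg (x 0)
      simp only [hy, Nat.cast_zero, zero_add]
      rw [abs_le]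
      constructor <;> linarith
    · push Not at h
      have h5 : 0 ≤ x j * (2 * α) - 2 / p := by
        rw [div_lt_iff₀ (by positivity)] at h; linarith
      refine ⟨⌊x j * (2 * α) - 2 / p⌋₊, ?_⟩
      have f1 := Nat.floor_le h5
      have f2 := Nat.lt_floor_add_one (x j * (2 * α) - 2 / p)
      have e : x j - y ⌊x j * (2 * α) - 2 / p⌋₊ =
          (x j * (2 * α) - 2 / p - ⌊x j * (2 * α) - 2 / p⌋₊) * (1 / (2 * α)) := by
        simp only [hy]; field_simp; ring
      rw [e, abs_mul, abs_of_pos (show 0 < 1 / (2 * α) by positivity),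
        abs_of_nonneg (by linarith)]
      have h2 : 0 < 1 / (2 * α) := by positivity
      have h3 : 0 < 2 / p / (2 * α) := by positivity
      have h4 := abs_nonneg (x 0)
      nlinarith
  choose κ hκ using near
  obtain ⟨B, hB, hKr⟩ := Kr_sum_fin (κ := 1 / (2 * α)) (by positivity)
  have hyk : ∀ i k : ℕ, 1 / (2 * α) * |(i : ℝ) - k| = |y i - y k| := by
    intro i k
    rw [← abs_of_pos (show 0 < 1 / (2 * α) by positivity), ← abs_mul]
    congr 1; simp only [hy]; ring
  set Q := A * C * (c⁻¹) ^ p with hQ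
  have hQ0 : 0 < Q := by positivity
  set e0 := Real.exp (-(p * (α * D ^ 2))) with he0
  have he00 : 0 < e0 := Real.exp_pos _
  have main : ∀ (m : ℕ) (F : Finset ℕ), (∀ j ∈ F, 1 ≤ j) → ∑ j ∈ F, Real.exp (-|x m - x j|) ≤
      Real.exp (2 * D) * e0⁻¹ * (B * Q) := by
    intro m F hF
    set G := F.image κ with hG
    have p1 : ∀ j ∈ F, Real.exp (-|x m - x j|) ≤ Real.exp (2 * D) * e0⁻¹ *
        ∑ k ∈ G, Real.exp (-(1 / (2 * α) * |(κ m : ℝ) - k|)) *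
          Real.exp (-(p * (α * (x j - y k) ^ 2))) := by
      intro j hj
      have hk : κ j ∈ G := Finset.mem_image_of_mem κ hj
      have q := Finset.single_le_sum (f := fun k : ℕ =>
        Real.exp (-(1 / (2 * α) * |(κ m : ℝ) - k|)) * Real.exp (-(p * (α * (x j - y k) ^ 2))))
        (fun k _ => by positivity) hk
      have q2 : e0 ≤ Real.exp (-(p * (α * (x j - y (κ j)) ^ 2))) := by
        rw [he0]
        apply Real.exp_le_exp.2
        have : (x j - y (κ j)) ^ 2 ≤ D ^ 2 := sq_le_sq' (abs_le.1 (hκ j)).1 (abs_le.1 (hκ j)).2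
        have : p * (α * (x j - y (κ j)) ^ 2) ≤ p * (α * D ^ 2) := by gcongr
        linarith
      have q3 : Real.exp (-|x m - x j|) ≤ Real.exp (2 * D) *
          Real.exp (-(1 / (2 * α) * |(κ m : ℝ) - κ j|)) := by
        rw [← Real.exp_add, hyk]
        apply Real.exp_le_exp.2
        have a1 := hκ m
        have a2 := hκ j
        have a3 : |y (κ m) - y (κ j)| ≤ |x m - x j| + 2 * D := by
          have : y (κ m) - y (κ j) = (x m - x j) + (-(x m - y (κ m)) + (x j - y (κ j))) := by ring
          rw [this]
          refine (abs_add_le _ _).trans (add_le_add le_rfl ((abs_add_le _ _).trans ?_))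
          rw [abs_neg]; linarith
        linarith
      calc Real.exp (-|x m - x j|) ≤ Real.exp (2 * D) *
          Real.exp (-(1 / (2 * α) * |(κ m : ℝ) - κ j|)) * (e0⁻¹ * e0) := by
            rw [inv_mul_cancel₀ he00.ne', mul_one]; exact q3
        _ = Real.exp (2 * D) * e0⁻¹ * (Real.exp (-(1 / (2 * α) * |(κ m : ℝ) - κ j|)) * e0) := by ring
        _ ≤ Real.exp (2 * D) * e0⁻¹ * (Real.exp (-(1 / (2 * α) * |(κ m : ℝ) - κ j|)) *
              Real.exp (-(p * (α * (x j - y (κ j)) ^ 2)))) := by gcongr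
        _ ≤ _ := by gcongr
    calc ∑ j ∈ F, Real.exp (-|x m - x j|) ≤ _ := Finset.sum_le_sum p1
      _ = Real.exp (2 * D) * e0⁻¹ * ∑ k ∈ G, Real.exp (-(1 / (2 * α) * |(κ m : ℝ) - k|)) *
          ∑ j ∈ F, Real.exp (-(p * (α * (x j - y k) ^ 2))) := by
          rw [← Finset.mul_sum, Finset.sum_comm]
          simp_rw [Finset.mul_sum]
      _ ≤ Real.exp (2 * D) * e0⁻¹ * ∑ k ∈ G, Real.exp (-(1 / (2 * α) * |(κ m : ℝ) - k|)) * Q := by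
          gcongr with k hk; exact stepA k F hF
      _ ≤ _ := by
          rw [← Finset.sum_mul]
          gcongr
          exact hKr _ _
  refine ⟨1 + Real.exp (2 * D) * e0⁻¹ * (B * Q), by positivity, fun m F => ?_⟩
  have h1 : ∑ j ∈ F, Real.exp (-|x m - x j|) ≤
      Real.exp (-|x m - x 0|) + ∑ j ∈ F.erase 0, Real.exp (-|x m - x j|) := by
    by_cases h0 : 0 ∈ F
    · rw [Finset.add_sum_erase F (fun j => Real.exp (-|x m - x j|)) h0]
    · rw [Finset.erase_eq_of_notMem h0]
      have := Real.exp_pos (-|x m - x 0|)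
      linarith
  have h2 := main m (F.erase 0) (fun j hj => Nat.one_le_iff_ne_zero.2 (Finset.ne_of_mem_erase hj))
  have h3 : Real.exp (-|x m - x 0|) ≤ 1 := Real.exp_le_one_iff.2 (by simp)
  linarith

lemma le_exp_of_log {w l C : ℝ} (hw : 0 < w) (h : |Real.log w - l| ≤ C) :
    w ≤ Real.exp (l + C) := by
  rw [← Real.log_le_iff_le_exp hw]; linarith [(abs_le.1 h).2]

lemma exp_le_of_log {w l C : ℝ} (hw : 0 < w) (h : |Real.log w - l| ≤ C) :
    Real.exp (l - C) ≤ w := by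
  rw [← Real.le_log_iff_exp_le hw]; linarith [(abs_le.1 h).1]

lemma max_sum2 {x : ℕ → ℝ} (hx : Monotone x) {n m : ℕ} (h : n ≤ m) :
    ∑ j ∈ Finset.range m, max (x n) (x j) =
      n * x n + ∑ j ∈ Finset.range m, x j - ∑ j ∈ Finset.range n, x j := by
  rcases h.eq_or_lt with h | h
  · subst h
    have : ∀ j ∈ Finset.range n, max (x n) (x j) = x n := by
      intro j hj
      exact max_eq_left (hx (by simp at hj; omega))
    rw [Finset.sum_congr rfl this]; simp
  · obtain ⟨N, rfl⟩ : ∃ N, m = N + 1 := ⟨m - 1, by omega⟩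
    rw [max_sum hx (by omega : n ≤ N), Finset.sum_range_succ x n]
    ring

lemma dual_exists {μ : ℕ → ℂ} {x : ℕ → ℝ} (S : PSeq μ x) {α p A : ℝ} (hp : 1 < p)
    (hLo : ∀ f, MemFock α p f → fockNormP α p f ≤ ENNReal.ofReal A *
      ∑' j, ENNReal.ofReal (‖f (μ j)‖ * Wt α p (μ j)) ^ p)
    (hI : ∀ v : ℕ → ℂ, ∑' j, ENNReal.ofReal (‖v j‖ * Wt α p (μ j)) ^ p < ⊤ →
      ∃ f, MemFock α p f ∧ ∀ j, f (μ j) = v j) (m : ℕ) :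
    ∃ f : ℂ → ℂ, Differentiable ℂ f ∧ (∀ j, j ≠ m → f (μ j) = 0) ∧
      ‖f (μ m)‖ * Wt α p (μ m) = 1 ∧ fockNormP α p f ≤ ENNReal.ofReal A := by
  have hp0 : 0 < p := by linarith
  have hW := Wt_pos α p (μ m)
  set v : ℕ → ℂ := fun j => if j = m then ((Wt α p (μ m))⁻¹ : ℝ) else 0 with hv
  have hvm : ‖v m‖ * Wt α p (μ m) = 1 := by
    simp only [hv, if_true, Complex.norm_real, norm_inv, Real.norm_eq_abs, abs_of_pos hW]
    exact inv_mul_cancel₀ hW.ne'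
  have hsum : ∑' j, ENNReal.ofReal (‖v j‖ * Wt α p (μ j)) ^ p = 1 := by
    rw [tsum_eq_single m]
    · rw [hvm]; simp
    · intro j hj
      simp [hv, hj, hp0]
  obtain ⟨f, hf, hfv⟩ := hI v (by rw [hsum]; exact ENNReal.one_lt_top)
  refine ⟨f, hf.1, fun j hj => ?_, by rw [hfv]; exact hvm, ?_⟩
  · rw [hfv]; simp [hv, hj]
  · have := hLo f hf
    simp_rw [hfv] at this
    rw [hsum, mul_one] at this
    exact this

lemma n1gen {μ : ℕ → ℂ} {x : ℕ → ℝ} (S : PSeq μ x) {α p : ℝ} (hα : 0 < α) (hp : 0 < p)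
    (hD : Dens x) : ∃ C : ℝ, 0 < C ∧ ∀ (m n : ℕ) (f : ℂ → ℂ) (Q : ℝ), m ≤ n → Differentiable ℂ f →
      (∀ j, j ≠ m → f (μ j) = 0) → ‖f (μ m)‖ * Wt α p (μ m) = 1 →
      ∏ j ∈ (Finset.range (n + 1)).erase m, ‖μ m - μ j‖ ≤ Real.exp Q →
      ∃ z : ℂ, ‖z‖ = Real.exp (x n + 1) ∧
        Real.exp (n * (x n + 1) - Q + α * x m ^ 2 - 2 / p * x m - α * (x n + 1) ^ 2
          + 2 / p * (x n + 1) - C) ≤ ‖f z‖ * Wt α p z := by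
  obtain ⟨D, hD0, hD⟩ := hD
  obtain ⟨C1, hC1, h1⟩ := S.log_W hα hp
  obtain ⟨C2, hC2, h2⟩ := log_Wt (p := p) hα hp (-(x 0))
  refine ⟨D + C1 + C2, by positivity, fun m n f Q hmn hf h0 hfm hQ => ?_⟩
  set F := (Finset.range (n + 1)).erase m with hF
  have hFn : ∀ j ∈ F, j ≤ n := fun j hj => by
    simp [hF] at hj; omega
  have hcard : F.card = n := by
    rw [hF, Finset.card_erase_of_mem (by simp; omega)]; simp
  obtain ⟨z, hz, hle⟩ := zeros_bound S.inj F hf (fun j hj => h0 j (Finset.ne_of_mem_erase hj))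
    (Real.exp_pos (x n + 1)) (w := μ m)
    (fun j hj => (S.le j).trans (Real.exp_le_exp.2 (by linarith [S.mono (hFn j hj)])))
    ((S.le m).trans (Real.exp_le_exp.2 (by linarith [S.mono hmn])))
  refine ⟨z, hz, ?_⟩
  have hWz := Wt_pos α p z
  have hWm := Wt_pos α p (μ m)
  have e1 : Real.exp (n * (x n + 1) - D) ≤ ∏ j ∈ F, (Real.exp (x n + 1) - ‖μ j‖) := by
    calc Real.exp (n * (x n + 1) - D)
        ≤ Real.exp (∑ j ∈ F, (x n + 1 - Real.exp (-|x n - x j|))) := by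
          apply Real.exp_le_exp.2
          rw [Finset.sum_sub_distrib, Finset.sum_const, hcard, nsmul_eq_mul]
          linarith [hD n F]
      _ = ∏ j ∈ F, Real.exp (x n + 1 - Real.exp (-|x n - x j|)) := Real.exp_sum _ _
      _ ≤ _ := by
          refine Finset.prod_le_prod (fun _ _ => (Real.exp_pos _).le) fun j hj => ?_
          have := exp_sub_exp_ge (S.mono (hFn j hj))
          linarith [S.le j]
  have e2 : Real.exp (α * x m ^ 2 - 2 / p * x m - C1) ≤ ‖f (μ m)‖ := by
    have : ‖f (μ m)‖ = (Wt α p (μ m))⁻¹ := eq_inv_of_mul_eq_one_left hfm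
    rw [this, le_inv_comm₀ (Real.exp_pos _) hWm, ← Real.exp_neg]
    refine (le_exp_of_log hWm (h1 m)).trans (Real.exp_le_exp.2 (by linarith))
  have e3 : Real.exp (-(α * (x n + 1) ^ 2) + 2 / p * (x n + 1) - C2) ≤ Wt α p z :=
    exp_le_of_log hWz (h2 z (x n + 1) hz (by linarith [S.mono (Nat.zero_le n)]))
  have e4 : Real.exp (α * x m ^ 2 - 2 / p * x m - C1) * Real.exp (n * (x n + 1) - D) ≤
      ‖f z‖ * Real.exp Q := by
    calc _ ≤ ‖f (μ m)‖ * ∏ j ∈ F, (Real.exp (x n + 1) - ‖μ j‖) := by gcongr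
      _ ≤ _ := hle
      _ ≤ _ := by gcongr
  rw [← Real.exp_add, ← div_le_iff₀ (Real.exp_pos _), ← Real.exp_sub] at e4
  calc _ = Real.exp (α * x m ^ 2 - 2 / p * x m - C1 + (n * (x n + 1) - D) - Q) *
        Real.exp (-(α * (x n + 1) ^ 2) + 2 / p * (x n + 1) - C2) := by
        rw [← Real.exp_add]; congr 1; ring
    _ ≤ _ := by gcongr

lemma n1core {μ : ℕ → ℂ} {x : ℕ → ℝ} (S : PSeq μ x) {α p : ℝ} (hα : 0 < α) (hp : 0 < p)
    (hD : Dens x) : ∃ C : ℝ, 0 < C ∧ ∀ (m n : ℕ) (f : ℂ → ℂ), m ≤ n → Differentiable ℂ f →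
      (∀ j, j ≠ m → f (μ j) = 0) → ‖f (μ m)‖ * Wt α p (μ m) = 1 →
      ∃ z : ℂ, ‖z‖ = Real.exp (x n + 1) ∧
        Real.exp (n * (x n + 1) - (m * x m + ∑ j ∈ Finset.range (n + 1), x j
            - ∑ j ∈ Finset.range (m + 1), x j)
          + α * x m ^ 2 - 2 / p * x m - α * (x n + 1) ^ 2
          + 2 / p * (x n + 1) - C) ≤ ‖f z‖ * Wt α p z := by
  obtain ⟨C, hC, h⟩ := n1gen S hα hp hD
  obtain ⟨D, hD0, hD⟩ := hD
  refine ⟨C + D, by positivity, fun m n f hmn hf h0 hfm => ?_⟩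
  obtain ⟨z, hz, hle⟩ := h m n f (m * x m + ∑ j ∈ Finset.range (n + 1), x j
            - ∑ j ∈ Finset.range (m + 1), x j + D) hmn hf h0 hfm (by
    calc _ ≤ ∏ j ∈ (Finset.range (n + 1)).erase m,
          Real.exp (max (x m) (x j) + Real.exp (-|x m - x j|)) :=
          Finset.prod_le_prod (fun _ _ => norm_nonneg _) fun j _ => S.sub_le m j
      _ = Real.exp (∑ j ∈ (Finset.range (n + 1)).erase m,
          (max (x m) (x j) + Real.exp (-|x m - x j|))) := (Real.exp_sum _ _).symm
      _ ≤ _ := by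
          apply Real.exp_le_exp.2
          rw [Finset.sum_add_distrib]
          have e := Finset.add_sum_erase (Finset.range (n + 1)) (fun j => max (x m) (x j))
            (show m ∈ _ by simp; omega)
          simp only [max_self] at e
          rw [max_sum S.mono hmn] at e
          linarith [hD m ((Finset.range (n + 1)).erase m)])
  refine ⟨z, hz, le_trans (Real.exp_le_exp.2 (le_of_eq ?_)) hle⟩
  ring

lemma d_lower {μ : ℕ → ℂ} {x : ℕ → ℝ} (S : PSeq μ x) {α p A : ℝ} (hα : 0 < α) (hp : 1 < p)
    (hA : 0 < A) (hD : Dens x)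
    (hdual : ∀ m : ℕ, ∃ f : ℂ → ℂ, Differentiable ℂ f ∧ (∀ j, j ≠ m → f (μ j) = 0) ∧
      ‖f (μ m)‖ * Wt α p (μ m) = 1 ∧ ∀ z, ‖f z‖ * Wt α p z ≤ A) :
    ∃ M : ℝ, ∀ m : ℕ, -M ≤ x m - (m + 2 / p) / (2 * α) := by
  have hp0 : 0 < p := by linarith
  obtain ⟨C, hC, h⟩ := n1core S hα hp0 hD
  refine ⟨(C + α + Real.log A) / (2 * α), fun m => ?_⟩
  obtain ⟨f, hf, h0, hfm, hb⟩ := hdual m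
  obtain ⟨z, hz, hle⟩ := h m m f le_rfl hf h0 hfm
  have h1 := hle.trans (hb z)
  rw [← Real.le_log_iff_exp_le hA] at h1
  rw [← neg_div, ← sub_nonneg]
  have e : x m - (m + 2 / p) / (2 * α) - -(C + α + Real.log A) / (2 * α) =
    (2 * α * x m - (m + 2 / p) + (C + α + Real.log A)) / (2 * α) := by field_simp; ring
  rw [e]
  apply div_nonneg _ (by positivity)
  nlinarith

/-- polynomial with the first `m` points as zeros -/
def Pm (μ : ℕ → ℂ) (m : ℕ) : Polynomial ℂ :=
  ∏ j ∈ Finset.range m, (Polynomial.X - Polynomial.C (μ j))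

lemma Pm_norm (μ : ℕ → ℂ) (m : ℕ) (z : ℂ) :
    ‖(Pm μ m).eval z‖ = ∏ j ∈ Finset.range m, ‖z - μ j‖ := by
  simp [Pm, Polynomial.eval_prod]

lemma Pm_fock {μ : ℕ → ℂ} {x : ℕ → ℝ} (S : PSeq μ x) {α p A M : ℝ} (hα : 0 < α) (hp : 1 < p)
    (hA : 0 < A) (hD : Dens x)
    (hLo : ∀ f, MemFock α p f → fockNormP α p f ≤ ENNReal.ofReal A *
      ∑' j, ENNReal.ofReal (‖f (μ j)‖ * Wt α p (μ j)) ^ p)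
    (hM : ∀ m : ℕ, -M ≤ x m - (m + 2 / p) / (2 * α)) :
    ∃ C : ℝ, 0 < C ∧ ∀ m : ℕ, fockNormP α p (fun z => (Pm μ m).eval z) ≤
      ENNReal.ofReal (C * Real.exp (p * ((m + 2 / p) * x m - α * x m ^ 2))) := by
  have hp0 : 0 < p := by linarith
  obtain ⟨D, hD0, hD⟩ := hD
  obtain ⟨C1, hC1, h1⟩ := S.log_W hα hp0
  set B := D + C1 + (2 * α * M + 1) ^ 2 / (4 * α) with hB
  refine ⟨A * (Real.exp (p * B) * D), by positivity, fun m => ?_⟩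
  set H := (m + 2 / p) * x m - α * x m ^ 2 with hH
  refine (hLo _ (poly_mem hα hp _)).trans ?_
  rw [mul_assoc, ENNReal.ofReal_mul hA.le]
  gcongr
  rw [ENNReal.tsum_eq_iSup_sum]
  refine iSup_le fun F => ?_
  have hterm : ∀ j ∈ F, ENNReal.ofReal (‖(Pm μ m).eval (μ j)‖ * Wt α p (μ j)) ^ p ≤
      ENNReal.ofReal (Real.exp (p * B) * Real.exp (p * H) * Real.exp (-|x m - x j|)) := by
    intro j _
    have hW := Wt_pos α p (μ j)
    rw [ENNReal.ofReal_rpow_of_nonneg (by positivity) hp0.le]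
    apply ENNReal.ofReal_le_ofReal
    rcases lt_or_ge j m with hj | hj
    · have : ‖(Pm μ m).eval (μ j)‖ = 0 := by
        rw [Pm_norm]
        exact Finset.prod_eq_zero (Finset.mem_range.2 hj) (by simp)
      rw [this, zero_mul, Real.zero_rpow hp0.ne']
      positivity
    · have hx : x m ≤ x j := S.mono hj
      have q1 : ‖(Pm μ m).eval (μ j)‖ ≤ Real.exp (m * x j + D) := by
        rw [Pm_norm]
        calc _ ≤ ∏ i ∈ Finset.range m, Real.exp (x j + Real.exp (-|x j - x i|)) := by
              refine Finset.prod_le_prod (fun _ _ => norm_nonneg _) fun i hi => ?_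
              have := S.sub_le j i
              rwa [max_eq_left (S.mono (by simp at hi; omega))] at this
          _ = Real.exp (∑ i ∈ Finset.range m, (x j + Real.exp (-|x j - x i|))) :=
              (Real.exp_sum _ _).symm
          _ ≤ _ := by
              apply Real.exp_le_exp.2
              rw [Finset.sum_add_distrib, Finset.sum_const, Finset.card_range, nsmul_eq_mul]
              linarith [hD j (Finset.range m)]
      have q2 := le_exp_of_log hW (h1 j)
      have q3 : ‖(Pm μ m).eval (μ j)‖ * Wt α p (μ j) ≤ Real.exp (B + H - |x m - x j|) := by
        calc _ ≤ Real.exp (m * x j + D) * Real.exp (-(α * x j ^ 2) + 2 / p * x j + C1) := by gcongr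
          _ = Real.exp (m * x j + D + (-(α * x j ^ 2) + 2 / p * x j + C1)) := (Real.exp_add _ _).symm
          _ ≤ _ := by
            apply Real.exp_le_exp.2
            rw [abs_sub_comm, abs_of_nonneg (sub_nonneg.2 hx), hB, hH]
            set y := x j - x m with hy
            have hy0 : 0 ≤ y := sub_nonneg.2 hx
            have ex : x j = x m + y := by rw [hy]; ring
            have hm := hM m
            have hm2 : (m + 2 / p) - 2 * α * x m ≤ 2 * α * M := by
              have e : (m + 2 / p) - 2 * α * x m =
                2 * α * (-(x m - (m + 2 / p) / (2 * α))) := by field_simp; ring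
              rw [e]; gcongr; linarith
            have hm3 : ((m + 2 / p) - 2 * α * x m) * y ≤ 2 * α * M * y := by gcongr
            have hq : (2 * α * M + 1) * y - α * y ^ 2 ≤ (2 * α * M + 1) ^ 2 / (4 * α) := by
              rw [le_div_iff₀ (by positivity)]
              nlinarith [sq_nonneg (2 * α * y - (2 * α * M + 1))]
            rw [ex]
            nlinarith
      calc _ ≤ Real.exp (B + H - |x m - x j|) ^ p := by gcongr
        _ = Real.exp (p * B + p * H + -(p * |x m - x j|)) := by
            rw [← Real.exp_mul]; congr 1; ring
        _ ≤ Real.exp (p * B + p * H + -|x m - x j|) := by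
            apply Real.exp_le_exp.2
            nlinarith [abs_nonneg (x m - x j)]
        _ = _ := by rw [Real.exp_add, Real.exp_add]
  refine (Finset.sum_le_sum hterm).trans ?_
  rw [← ENNReal.ofReal_sum_of_nonneg (fun _ _ => by positivity), ← Finset.mul_sum]
  apply ENNReal.ofReal_le_ofReal
  calc _ ≤ Real.exp (p * B) * Real.exp (p * H) * D := by gcongr; exact hD m F
    _ = _ := by ring

lemma d_upper {μ : ℕ → ℂ} {x : ℕ → ℝ} (S : PSeq μ x) {α p C : ℝ} (hα : 0 < α) (hp : 1 < p)
    (hC : 0 < C)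
    (hP : ∀ m : ℕ, fockNormP α p (fun z => (Pm μ m).eval z) ≤
      ENNReal.ofReal (C * Real.exp (p * ((m + 2 / p) * x m - α * x m ^ 2)))) :
    ∃ M : ℝ, ∀ m : ℕ, x m - (m + 2 / p) / (2 * α) ≤ M := by
  have hp0 : 0 < p := by linarith
  obtain ⟨C2, hC2, h2⟩ := log_Wt (p := p) hα hp0 (1 - x 0)
  obtain ⟨C3, hC3, h3⟩ := eval_point hα hp
  refine ⟨(Real.log (C3 * C) / p + C2 + α) / (2 * α), fun m => ?_⟩
  obtain ⟨z, hz, hle⟩ := jensen_lower μ (Finset.range m) (Real.exp_pos (x m - 1))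
  have hW := Wt_pos α p z
  have q1 : Real.exp (m * (x m - 1)) ≤ ‖(Pm μ m).eval z‖ := by
    rw [Pm_norm]
    refine le_trans ?_ hle
    calc Real.exp (m * (x m - 1)) = ∏ j ∈ Finset.range m, Real.exp (x m - 1) := by
          rw [Finset.prod_const, Finset.card_range, ← Real.exp_nat_mul]
      _ ≤ _ := Finset.prod_le_prod (fun _ _ => (Real.exp_pos _).le) fun _ _ => le_max_left _ _
  have q2 := exp_le_of_log hW (h2 z (x m - 1) hz (by linarith [S.mono (Nat.zero_le m)]))
  have q3 : Real.exp (m * (x m - 1) + (-(α * (x m - 1) ^ 2) + 2 / p * (x m - 1) - C2)) ≤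
      ‖(Pm μ m).eval z‖ * Wt α p z := by
    rw [Real.exp_add]; gcongr
  have q4 := (h3 (fun z => (Pm μ m).eval z) (Pm μ m).differentiable z).trans
    (mul_le_mul' le_rfl (hP m))
  rw [← ENNReal.ofReal_mul hC3.le, ENNReal.ofReal_rpow_of_nonneg (by positivity) hp0.le,
    ENNReal.ofReal_le_ofReal_iff (by positivity)] at q4
  have q5 : Real.exp (m * (x m - 1) + (-(α * (x m - 1) ^ 2) + 2 / p * (x m - 1) - C2)) ^ p ≤
    C3 * (C * Real.exp (p * ((m + 2 / p) * x m - α * x m ^ 2))) := le_trans (by gcongr) q4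
  rw [← Real.exp_mul, ← mul_assoc, ← Real.exp_log (show 0 < C3 * C by positivity), ← Real.exp_add,
    Real.exp_le_exp] at q5
  have q6 : m * (x m - 1) + (-(α * (x m - 1) ^ 2) + 2 / p * (x m - 1) - C2) ≤
      Real.log (C3 * C) / p + ((m + 2 / p) * x m - α * x m ^ 2) := by
    rw [← sub_le_iff_le_add, le_div_iff₀ hp0]
    linarith
  rw [le_div_iff₀ (by positivity)]
  have e : (x m - (m + 2 / p) / (2 * α)) * (2 * α) = 2 * α * x m - (m + 2 / p) := by
    field_simp
  rw [e]
  nlinarith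

lemma nec_sep {μ : ℕ → ℂ} {x : ℕ → ℝ} (S : PSeq μ x) {α p A M : ℝ} (hα : 0 < α) (hp : 1 < p)
    (hA : 0 < A) (hD : Dens x)
    (hdual : ∀ m : ℕ, ∃ f : ℂ → ℂ, Differentiable ℂ f ∧ (∀ j, j ≠ m → f (μ j) = 0) ∧
      ‖f (μ m)‖ * Wt α p (μ m) = 1 ∧ ∀ z, ‖f z‖ * Wt α p z ≤ A)
    (hM : ∀ m : ℕ, x m - (m + 2 / p) / (2 * α) ≤ M) : RSep μ x := by
  have hp0 : 0 < p := by linarith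
  obtain ⟨C, hC, h⟩ := n1gen S hα hp0 hD
  obtain ⟨D, hD0, hD⟩ := hD
  refine ⟨Real.exp (-(2 * α * M) - D - α - C - Real.log A), Real.exp_pos _, fun i m him => ?_⟩
  obtain ⟨f, hf, h0, hfm, hb⟩ := hdual m
  have hne : 0 < ‖μ m - μ i‖ := norm_pos_iff.2 (sub_ne_zero.2 (fun e => him.ne' (S.inj e)))
  have hF : (Finset.range (m + 1)).erase m = Finset.range m := by
    ext j; simp; omega
  obtain ⟨z, hz, hle⟩ := h m m f (Real.log ‖μ m - μ i‖ + ((m - 1) * x m + D)) le_rfl hf h0 hfm (by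
    rw [hF, ← Finset.mul_prod_erase _ _ (Finset.mem_range.2 him), Real.exp_add, Real.exp_log hne]
    gcongr
    calc _ ≤ ∏ j ∈ (Finset.range m).erase i, Real.exp (x m + Real.exp (-|x m - x j|)) := by
            refine Finset.prod_le_prod (fun _ _ => norm_nonneg _) fun j hj => ?_
            have := S.sub_le m j
            rwa [max_eq_left (S.mono (by simp at hj; omega))] at this
      _ = Real.exp (∑ j ∈ (Finset.range m).erase i, (x m + Real.exp (-|x m - x j|))) :=
          (Real.exp_sum _ _).symm
      _ ≤ _ := by
        apply Real.exp_le_exp.2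
        rw [Finset.sum_add_distrib, Finset.sum_const, Finset.card_erase_of_mem
          (Finset.mem_range.2 him), Finset.card_range, nsmul_eq_mul,
          Nat.cast_sub (by omega : 1 ≤ m), Nat.cast_one]
        linarith [hD m ((Finset.range m).erase i)])
  have h1 := hle.trans (hb z)
  rw [← Real.le_log_iff_exp_le hA] at h1
  rw [← Real.exp_add, ← Real.le_log_iff_exp_le hne]
  have e : 2 * α * x m - (m + 2 / p) ≤ 2 * α * M := by
    have e : 2 * α * x m - (m + 2 / p) = 2 * α * (x m - (m + 2 / p) / (2 * α)) := by
      field_simp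
    rw [e]; gcongr; exact hM m
  nlinarith

lemma arith_h {α a τ n xn dn s X : ℝ} (h : α * a = 1 / 2) (hx : xn = a * (n + τ) + dn)
    (hX : X = s + a * (n * (n - 1) / 2 + τ * n)) :
    (n + τ) * xn - α * xn ^ 2 - X = a * n / 2 + a * τ ^ 2 / 2 - s - α * dn ^ 2 := by
  subst hx hX
  linear_combination (-(a * (n + τ) ^ 2) - 2 * (n + τ) * dn) * h

lemma nec_t {μ : ℕ → ℂ} {x : ℕ → ℝ} (S : PSeq μ x) {α p A M : ℝ} (hα : 0 < α) (hp : 1 < p)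
    (hA : 0 < A) (hD : Dens x)
    (hdual : ∀ m : ℕ, ∃ f : ℂ → ℂ, Differentiable ℂ f ∧ (∀ j, j ≠ m → f (μ j) = 0) ∧
      ‖f (μ m)‖ * Wt α p (μ m) = 1 ∧ fockNormP α p f ≤ ENNReal.ofReal A)
    (hd : ∀ j : ℕ, |x j - (j + 2 / p) / (2 * α)| ≤ M) :
    ∃ C : ℝ, 1 < C ∧ ∀ m N : ℕ, m < N →
      ∑ n ∈ Finset.Ico m N, Real.exp (p * (-(1 / (4 * α) * n) - sd α p x n)) ≤
        C * Real.exp (p * (-(1 / (4 * α) * m) - sd α p x m)) := by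
  have hp0 : 0 < p := by linarith
  have hM0 : 0 ≤ M := (abs_nonneg _).trans (hd 0)
  obtain ⟨C, hC, h⟩ := n1core S hα hp0 hD
  obtain ⟨C4, hC4, h4⟩ := eval_sum hα hp (M + 1 + 2 / p / (2 * α))
  set B := C + α + 2 * α * M + α * M ^ 2 + 2 * M with hB
  have hB0 : 0 < B := by positivity
  refine ⟨1 + C4 * A * Real.exp (p * B), by linarith [show 0 < C4 * A * Real.exp (p * B) by positivity],
    fun m N _ => ?_⟩
  obtain ⟨f, hf, h0, hfm, hfA⟩ := hdual m
  have hz : ∀ n : ℕ, ∃ z : ℂ, |logPlus ‖z‖ - n / (2 * α)| ≤ M + 1 + 2 / p / (2 * α) ∧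
      (m ≤ n → Real.exp ((-(1 / (4 * α) * n) - sd α p x n) - (-(1 / (4 * α) * m) - sd α p x m) - B) ≤
        ‖f z‖ * Wt α p z) := by
    intro n
    rcases lt_or_ge n m with hn | hn
    · refine ⟨(Real.exp (n / (2 * α)) : ℂ), (exists_near hα n).trans (by positivity), fun h => by omega⟩
    · obtain ⟨z, hz, hle⟩ := h m n f hn hf h0 hfm
      refine ⟨z, near_exp hα hz n ?_, fun _ => le_trans (Real.exp_le_exp.2 ?_) hle⟩
      · have := abs_le.1 (hd n)
        have e : (n + 2 / p) / (2 * α) = n / (2 * α) + 2 / p / (2 * α) := by ring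
        have e2 : 0 < 2 / p / (2 * α) := by positivity
        rw [e] at this
        rw [abs_le]; constructor <;> linarith
      · have e1 := arith_h (α := α) (a := 1 / (2 * α)) (τ := 2 / p) (n := n) (xn := x n)
          (dn := x n - (n + 2 / p) / (2 * α)) (s := sd α p x n) (by field_simp) (by ring)
          ((sum_x α p x n).trans (by ring))
        have e2 := arith_h (α := α) (a := 1 / (2 * α)) (τ := 2 / p) (n := m) (xn := x m)
          (dn := x m - (m + 2 / p) / (2 * α)) (s := sd α p x m) (by field_simp) (by ring)
          ((sum_x α p x m).trans (by ring))
        rw [Finset.sum_range_succ x n, Finset.sum_range_succ x m]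
        have a1 := abs_le.1 (hd n)
        have a2 := abs_le.1 (hd m)
        set dn := x n - (n + 2 / p) / (2 * α) with hdn
        set dm := x m - (m + 2 / p) / (2 * α) with hdm
        have exn : x n = n * (1 / (2 * α)) + 2 / p * (1 / (2 * α)) + dn := by rw [hdn]; ring
        have exm : x m = m * (1 / (2 * α)) + 2 / p * (1 / (2 * α)) + dm := by rw [hdm]; ring
        have e3 : n + 2 / p - 2 * α * x n = - (2 * α * dn) := by
          rw [hdn]; field_simp; ring
        have e4 : α * dn ^ 2 ≤ α * M ^ 2 := by
          have : dn ^ 2 ≤ M ^ 2 := sq_le_sq' a1.1 a1.2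
          gcongr
        have e5 : 0 ≤ α * dm ^ 2 := by positivity
        have e6 : α * dn ≤ α * M := by gcongr; exact a1.2
        have e7 : 1 / (4 * α) * n = n * (1 / (2 * α)) / 2 := by ring
        have e8 : 1 / (4 * α) * m = m * (1 / (2 * α)) / 2 := by ring
        rw [e7, e8, hB]
        nlinarith
  choose z hz1 hz2 using hz
  have q := (ENNReal.sum_le_tsum (Finset.Ico m N)).trans
    ((h4 f hf z hz1).trans (mul_le_mul' le_rfl hfA))
  set tm := Real.exp (p * (-(1 / (4 * α) * m) - sd α p x m)) with htm
  have htm0 : 0 < tm := Real.exp_pos _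
  have q2 : ENNReal.ofReal (∑ n ∈ Finset.Ico m N, Real.exp (p * (-(1 / (4 * α) * n) - sd α p x n)) *
      (tm⁻¹ * Real.exp (-(p * B)))) ≤ ENNReal.ofReal (C4 * A) := by
    rw [ENNReal.ofReal_mul hC4.le]
    refine le_trans ?_ q
    rw [ENNReal.ofReal_sum_of_nonneg (fun _ _ => by positivity)]
    refine Finset.sum_le_sum fun n hn => ?_
    rw [ENNReal.ofReal_rpow_of_nonneg (mul_nonneg (norm_nonneg _) (Wt_pos _ _ _).le) hp0.le]
    apply ENNReal.ofReal_le_ofReal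
    refine le_trans (le_of_eq ?_) (Real.rpow_le_rpow (Real.exp_pos _).le
      (hz2 n (Finset.mem_Ico.1 hn).1) hp0.le)
    rw [htm, ← Real.exp_neg, ← Real.exp_add, ← Real.exp_add, ← Real.exp_mul]
    congr 1; ring
  rw [ENNReal.ofReal_le_ofReal_iff (by positivity), ← Finset.sum_mul, ← mul_assoc,
    Real.exp_neg, ← div_eq_mul_inv, ← div_eq_mul_inv, div_le_iff₀ (by positivity),
    div_le_iff₀ htm0] at q2
  linarith

lemma nec_t2 {μ : ℕ → ℂ} {x : ℕ → ℝ} (S : PSeq μ x) {α p C M : ℝ} (hα : 0 < α) (hp : 1 < p)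
    (hC : 0 < C)
    (hP : ∀ m : ℕ, fockNormP α p (fun z => (Pm μ m).eval z) ≤
      ENNReal.ofReal (C * Real.exp (p * ((m + 2 / p) * x m - α * x m ^ 2))))
    (hd : ∀ j : ℕ, |x j - (j + 2 / p) / (2 * α)| ≤ M) :
    ∃ C : ℝ, 1 < C ∧ ∀ n m : ℕ, n ≤ m →
      ∑ i ∈ Finset.Ico n (m + 1), Real.exp (p * (1 / (4 * α) * i - sd α p x i)) ≤
        C * Real.exp (p * (1 / (4 * α) * m - sd α p x m)) := by
  have hp0 : 0 < p := by linarith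
  have hM0 : 0 ≤ M := (abs_nonneg _).trans (hd 0)
  obtain ⟨C2, hC2, h2⟩ := log_Wt (p := p) hα hp0 (-(x 0))
  obtain ⟨C4, hC4, h4⟩ := eval_sum hα hp (M + 2 / p / (2 * α))
  set B := C2 + α * M ^ 2 with hB
  refine ⟨1 + C4 * C * Real.exp (p * B), by linarith [show 0 < C4 * C * Real.exp (p * B) by positivity],
    fun k m _ => ?_⟩
  have harith : ∀ n : ℕ, ∃ e, 0 ≤ e ∧ e ≤ α * M ^ 2 ∧
      (n + 2 / p) * x n - α * x n ^ 2 - ∑ j ∈ Finset.range n, x j =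
      1 / (4 * α) * n - sd α p x n + 1 / (2 * α) * (2 / p) ^ 2 / 2 - e := by
    intro n
    have e1 := arith_h (α := α) (a := 1 / (2 * α)) (τ := 2 / p) (n := n) (xn := x n)
      (dn := x n - (n + 2 / p) / (2 * α)) (s := sd α p x n) (by field_simp) (by ring)
      ((sum_x α p x n).trans (by ring))
    have a1 := abs_le.1 (hd n)
    refine ⟨α * (x n - (n + 2 / p) / (2 * α)) ^ 2, by positivity, ?_, ?_⟩
    · have := sq_le_sq' a1.1 a1.2
      gcongr
    · rw [e1]; ring
  have hz : ∀ n : ℕ, ∃ z : ℂ, |logPlus ‖z‖ - n / (2 * α)| ≤ M + 2 / p / (2 * α) ∧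
      (n ≤ m → Real.exp ((1 / (4 * α) * n - sd α p x n) - (1 / (4 * α) * m - sd α p x m) - B
          + ((m + 2 / p) * x m - α * x m ^ 2)) ≤
        ‖(Pm μ m).eval z‖ * Wt α p z) := by
    intro n
    rcases lt_or_ge m n with hn | hn
    · refine ⟨(Real.exp (n / (2 * α)) : ℂ), (exists_near hα n).trans (by positivity), fun h => by omega⟩
    · obtain ⟨z, hz, hle⟩ := jensen_lower μ (Finset.range m) (Real.exp_pos (x n))
      have hW := Wt_pos α p z
      refine ⟨z, near_exp hα hz n ?_, fun _ => ?_⟩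
      · have := abs_le.1 (hd n)
        have e : (n + 2 / p) / (2 * α) = n / (2 * α) + 2 / p / (2 * α) := by ring
        have e2 : 0 < 2 / p / (2 * α) := by positivity
        rw [e] at this
        rw [abs_le]; constructor <;> linarith
      · have q1 : Real.exp (n * x n + ∑ j ∈ Finset.range m, x j - ∑ j ∈ Finset.range n, x j) ≤
            ‖(Pm μ m).eval z‖ := by
          rw [Pm_norm, ← max_sum2 S.mono hn, Real.exp_sum]
          refine le_trans ?_ hle
          refine Finset.prod_le_prod (fun _ _ => (Real.exp_pos _).le) fun j _ => ?_
          rcases Nat.eq_zero_or_pos j with hj | hj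
          · subst hj
            rw [max_eq_left (S.mono (Nat.zero_le n))]; exact le_max_left _ _
          · rw [S.h1 j hj, Real.exp_monotone.map_max]
        have q2 := exp_le_of_log hW (h2 z (x n) hz (by linarith [S.mono (Nat.zero_le n)]))
        refine le_trans ?_ (mul_le_mul q1 q2 (Real.exp_pos _).le (norm_nonneg _))
        rw [← Real.exp_add]
        apply Real.exp_le_exp.2
        obtain ⟨en, en0, en1, en2⟩ := harith n
        obtain ⟨em, em0, em1, em2⟩ := harith m
        rw [hB]
        linarith
  choose z hz1 hz2 using hz
  have q := (ENNReal.sum_le_tsum (Finset.Ico k (m + 1))).trans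
    ((h4 (fun z => (Pm μ m).eval z) (Pm μ m).differentiable z hz1).trans (mul_le_mul' le_rfl (hP m)))
  set tm := Real.exp (p * (1 / (4 * α) * m - sd α p x m)) with htm
  have htm0 : 0 < tm := Real.exp_pos _
  set H := Real.exp (p * ((m + 2 / p) * x m - α * x m ^ 2)) with hH
  have hH0 : 0 < H := Real.exp_pos _
  have q2 : ENNReal.ofReal (∑ n ∈ Finset.Ico k (m + 1), Real.exp (p * (1 / (4 * α) * n - sd α p x n)) *
      (tm⁻¹ * Real.exp (-(p * B)) * H)) ≤ ENNReal.ofReal (C4 * (C * H)) := by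
    rw [ENNReal.ofReal_mul hC4.le]
    refine le_trans ?_ q
    rw [ENNReal.ofReal_sum_of_nonneg (fun _ _ => by positivity)]
    refine Finset.sum_le_sum fun n hn => ?_
    rw [ENNReal.ofReal_rpow_of_nonneg (mul_nonneg (norm_nonneg _) (Wt_pos _ _ _).le) hp0.le]
    apply ENNReal.ofReal_le_ofReal
    refine le_trans (le_of_eq ?_) (Real.rpow_le_rpow (Real.exp_pos _).le
      (hz2 n (by have := Finset.mem_Ico.1 hn; omega)) hp0.le)
    rw [htm, hH, ← Real.exp_neg, ← Real.exp_add, ← Real.exp_add, ← Real.exp_add, ← Real.exp_mul]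
    congr 1; ring
  rw [ENNReal.ofReal_le_ofReal_iff (by positivity), ← Finset.sum_mul, ← mul_assoc, ← mul_assoc,
    ← mul_assoc C4] at q2
  have q3 := le_of_mul_le_mul_right q2 hH0
  rw [Real.exp_neg, ← div_eq_mul_inv, ← div_eq_mul_inv, div_le_iff₀ (by positivity),
    div_le_iff₀ htm0] at q3
  linarith

lemma exists_hc {α p C1 C2 : ℝ} {x : ℕ → ℝ} (hp : 1 < p) (hC1 : 1 < C1) (hC2 : 1 < C2)
    (h1 : ∀ m N : ℕ, m < N →
      ∑ n ∈ Finset.Ico m N, Real.exp (p * (-(1 / (4 * α) * n) - sd α p x n)) ≤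
        C1 * Real.exp (p * (-(1 / (4 * α) * m) - sd α p x m)))
    (h2 : ∀ n m : ℕ, n ≤ m →
      ∑ i ∈ Finset.Ico n (m + 1), Real.exp (p * (1 / (4 * α) * i - sd α p x i)) ≤
        C2 * Real.exp (p * (1 / (4 * α) * m - sd α p x m))) :
    ∃ ε K : ℝ, 0 < ε ∧ ∀ m n : ℕ, m ≤ n →
      |sd α p x n - sd α p x m| ≤ (1 / (4 * α) - ε) * (n - m) + K := by
  have hp0 : 0 < p := by linarith
  have hpos : ∀ C : ℝ, 1 < C → 0 < 1 - C⁻¹ ∧ Real.log (1 - C⁻¹) < 0 := by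
    intro C hC
    have h1 : C⁻¹ < 1 := inv_lt_one_of_one_lt₀ hC
    have h2 : 0 < C⁻¹ := by positivity
    exact ⟨by linarith, Real.log_neg (by linarith) (by linarith)⟩
  obtain ⟨a1, b1⟩ := hpos C1 hC1
  obtain ⟨a2, b2⟩ := hpos C2 hC2
  set l1 := Real.log (1 - C1⁻¹)
  set l2 := Real.log (1 - C2⁻¹)
  set ε := min (-l1 / p) (-l2 / p) with hε
  have hε0 : 0 < ε := lt_min (div_pos (by linarith) hp0) (div_pos (by linarith) hp0)
  have k1 : ε * p ≤ -l1 := by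
    rw [← le_div_iff₀ hp0]; exact min_le_left _ _
  have k2 : ε * p ≤ -l2 := by
    rw [← le_div_iff₀ hp0]; exact min_le_right _ _
  refine ⟨ε, max (Real.log C1 / p) (Real.log C2 / p), hε0, fun m n hmn => ?_⟩
  obtain ⟨k, rfl⟩ := Nat.exists_eq_add_of_le hmn
  have g1 := disc_decay hC1 (t := fun n : ℕ => Real.exp (p * (-(1 / (4 * α) * n) - sd α p x n)))
    (fun _ => Real.exp_pos _) h1 m k
  have g2 := disc_growth hC2 (t := fun n : ℕ => Real.exp (p * (1 / (4 * α) * n - sd α p x n)))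
    (fun _ => Real.exp_pos _) h2 m k
  have hk : (0 : ℝ) ≤ k := Nat.cast_nonneg k
  have c1 : (0 : ℝ) < C1 := by linarith
  have c2 : (0 : ℝ) < C2 := by linarith
  beta_reduce at g1 g2
  rw [← Real.log_le_log_iff (by positivity) (by positivity), Real.log_exp,
    Real.log_mul (by positivity) (by positivity), Real.log_mul (by positivity) (by positivity),
    Real.log_pow, Real.log_exp] at g1 g2
  push_cast at g1 g2 ⊢
  have m1 : Real.log C1 / p ≤ max (Real.log C1 / p) (Real.log C2 / p) := le_max_left _ _
  have m2 : Real.log C2 / p ≤ max (Real.log C1 / p) (Real.log C2 / p) := le_max_right _ _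
  have n1 : k * l1 ≤ -(k * ε * p) := by nlinarith
  have n2 : k * l2 ≤ -(k * ε * p) := by nlinarith
  have r1 : -(1 / (4 * α) * (m + k)) - sd α p x (m + k) ≤
      Real.log C1 / p - k * ε + (-(1 / (4 * α) * m) - sd α p x m) := by
    rw [← sub_le_iff_le_add, ← sub_nonneg]
    have : 0 ≤ (Real.log C1 - k * ε * p - p * (-(1 / (4 * α) * (m + k)) - sd α p x (m + k)
      - (-(1 / (4 * α) * m) - sd α p x m))) / p := div_nonneg (by linarith) hp0.le
    refine this.trans (le_of_eq ?_)
    field_simp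
  have r2 : (1 / (4 * α) * m) - sd α p x m ≤
      Real.log C2 / p - k * ε + ((1 / (4 * α) * (m + k)) - sd α p x (m + k)) := by
    rw [← sub_le_iff_le_add, ← sub_nonneg]
    have : 0 ≤ (Real.log C2 - k * ε * p - p * ((1 / (4 * α) * m) - sd α p x m
      - ((1 / (4 * α) * (m + k)) - sd α p x (m + k)))) / p := div_nonneg (by linarith) hp0.le
    refine this.trans (le_of_eq ?_)
    field_simp
  rw [abs_le]
  constructor <;> nlinarith

lemma necessity {μ : ℕ → ℂ} {x : ℕ → ℝ} (S : PSeq μ x) {α p A : ℝ} (hα : 0 < α) (hp : 1 < p)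
    (hA : 0 < A)
    (hU : ∀ f, MemFock α p f → ∑' j, ENNReal.ofReal (‖f (μ j)‖ * Wt α p (μ j)) ^ p ≤
      ENNReal.ofReal A * fockNormP α p f)
    (hLo : ∀ f, MemFock α p f → fockNormP α p f ≤ ENNReal.ofReal A *
      ∑' j, ENNReal.ofReal (‖f (μ j)‖ * Wt α p (μ j)) ^ p)
    (hI : ∀ v : ℕ → ℂ, ∑' j, ENNReal.ofReal (‖v j‖ * Wt α p (μ j)) ^ p < ⊤ →
      ∃ f, MemFock α p f ∧ ∀ j, f (μ j) = v j) :
    RSep μ x ∧ (∃ M, ∀ j : ℕ, |x j - (j + 2 / p) / (2 * α)| ≤ M) ∧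
    ∃ ε K : ℝ, 0 < ε ∧ ∀ m n : ℕ, m ≤ n →
      |sd α p x n - sd α p x m| ≤ (1 / (4 * α) - ε) * (n - m) + K := by
  have hp0 : 0 < p := by linarith
  have hD := nec_dens S hα hp hA hU
  have hdual := dual_exists S hp hLo hI
  obtain ⟨C3, hC3, h3⟩ := eval_point hα hp
  have hdual2 : ∀ m : ℕ, ∃ f : ℂ → ℂ, Differentiable ℂ f ∧ (∀ j, j ≠ m → f (μ j) = 0) ∧
      ‖f (μ m)‖ * Wt α p (μ m) = 1 ∧ ∀ z, ‖f z‖ * Wt α p z ≤ (C3 * A) ^ p⁻¹ := by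
    intro m
    obtain ⟨f, a, b, c, d⟩ := hdual m
    refine ⟨f, a, b, c, fun z => ?_⟩
    have hn : 0 ≤ ‖f z‖ * Wt α p z := mul_nonneg (norm_nonneg _) (Wt_pos _ _ _).le
    have := (h3 f a z).trans (mul_le_mul' le_rfl d)
    rw [← ENNReal.ofReal_mul hC3.le, ENNReal.ofReal_rpow_of_nonneg hn hp0.le,
      ENNReal.ofReal_le_ofReal_iff (by positivity)] at this
    exact (Real.le_rpow_inv_iff_of_pos hn (by positivity) hp0).2 this
  have hA2 : 0 < (C3 * A) ^ p⁻¹ := by positivity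
  obtain ⟨M1, hM1⟩ := d_lower S hα hp hA2 hD hdual2
  obtain ⟨C5, hC5, hP⟩ := Pm_fock S hα hp hA hD hLo hM1
  obtain ⟨M2, hM2⟩ := d_upper S hα hp hC5 hP
  have hs := nec_sep S hα hp hA2 hD hdual2 hM2
  have hd : ∀ j : ℕ, |x j - (j + 2 / p) / (2 * α)| ≤ max M1 M2 := by
    intro j
    rw [abs_le]
    exact ⟨by linarith [le_max_left M1 M2, hM1 j], (hM2 j).trans (le_max_right _ _)⟩
  obtain ⟨C6, hC6, h6⟩ := nec_t S hα hp hA hD hdual hd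
  obtain ⟨C7, hC7, h7⟩ := nec_t2 S hα hp hC5 hP hd
  exact ⟨hs, ⟨_, hd⟩, exists_hc hp hC6 hC7 h6 h7⟩

lemma cis_nec {μ : ℕ → ℂ} {x : ℕ → ℝ} (S : PSeq μ x) {α p : ℝ} (hα : 0 < α) (hp : 1 < p)
    (h : CompleteInterpolating α p (Set.range μ)) :
    RSep μ x ∧ (∃ M, ∀ j : ℕ, |x j - (j + 2 / p) / (2 * α)| ≤ M) ∧
    ∃ ε K : ℝ, 0 < ε ∧ ∀ m n : ℕ, m ≤ n →
      |sd α p x n - sd α p x m| ≤ (1 / (4 * α) - ε) * (n - m) + K := by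
  have hp0 : 0 < p := by linarith
  obtain ⟨⟨C, hC, hs⟩, hi⟩ := h
  have hC0 : 0 < C := by linarith
  refine necessity S hα hp hC0 (fun f hf => ?_) (fun f hf => ?_) (fun v hv => ?_)
  · rw [← disc_eq S.inj hp0]; exact (hs f hf).2
  · rw [← disc_eq S.inj hp0]
    exact (ENNReal.inv_mul_le_iff (by simpa using hC0) ENNReal.ofReal_ne_top).1 (hs f hf).1
  · have he : ∀ j, Function.extend μ v 0 (μ j) = v j := fun j => S.inj.extend_apply v 0 j
    obtain ⟨f, hf, hfv⟩ := hi (Function.extend μ v 0) (by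
      rw [disc_eq S.inj hp0]; simp_rw [he]; exact hv)
    exact ⟨f, hf, fun j => by rw [hfv _ ⟨j, rfl⟩, he]⟩

/-- prepend a point -/
def muS (g : ℂ) (γ : ℕ → ℂ) : ℕ → ℂ
  | 0 => g
  | n + 1 => γ n

/-- logarithms of the moduli -/
def xS (α : ℝ) (δ : ℕ → ℝ) : ℕ → ℝ
  | 0 => 1 / (2 * α) + δ 0
  | n + 1 => (1 + (n : ℝ)) / (2 * α) + δ n

lemma range_muS (g : ℂ) (γ : ℕ → ℂ) : Set.range (muS g γ) = insert g (Set.range γ) := by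
  ext z
  simp only [Set.mem_range, Set.mem_insert_iff]
  constructor
  · rintro ⟨n, rfl⟩
    cases n with
    | zero => left; rfl
    | succ n => right; exact ⟨n, rfl⟩
  · rintro (rfl | ⟨n, rfl⟩)
    · exact ⟨0, rfl⟩
    · exact ⟨n + 1, rfl⟩

lemma pseqS {α : ℝ} {γ : ℕ → ℂ} {δ : ℕ → ℝ} {g : ℂ} (hinj : Function.Injective γ)
    (hmono : ∀ n, ‖γ n‖ ≤ ‖γ (n + 1)‖)
    (hn : ∀ n : ℕ, ‖γ n‖ = Real.exp ((1 + (n : ℝ)) / (2 * α) + δ n))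
    (hg : g ∉ Set.range γ) (hg0 : ‖g‖ ≤ ‖γ 0‖) : PSeq (muS g γ) (xS α δ) where
  mono := by
    apply monotone_nat_of_le_succ
    intro n
    cases n with
    | zero => simp [xS]
    | succ n =>
      have := hmono n
      rw [hn, hn, Real.exp_le_exp] at this
      exact this
  h0 := by
    have h0 := hn 0
    rw [h0] at hg0
    simpa [muS, xS] using hg0
  h1 := by
    intro j hj
    obtain ⟨n, rfl⟩ : ∃ n, j = n + 1 := ⟨j - 1, by omega⟩
    exact hn n
  inj := by
    intro i j h
    cases i with
    | zero =>
      cases j with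
      | zero => rfl
      | succ j => exact absurd ⟨j, h.symm⟩ hg
    | succ i =>
      cases j with
      | zero => exact absurd ⟨i, h⟩ hg
      | succ j => rw [hinj h]

/-- block sums -/
def TT (α p : ℝ) (δ : ℕ → ℝ) (n k : ℕ) : ℝ := ∑ i ∈ Finset.range k, (δ (n + i) - 1 / (p * α))

lemma xS_dev {α p : ℝ} (hα : 0 < α) (hp : 0 < p) (δ : ℕ → ℝ) (n : ℕ) :
    xS α δ (n + 1) - (((n + 1 : ℕ) : ℝ) + 2 / p) / (2 * α) = δ n - 1 / (p * α) := by
  simp only [xS]; push_cast; field_simp; ring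

lemma sd_TT {α p : ℝ} (hα : 0 < α) (hp : 0 < p) (δ : ℕ → ℝ) (n k : ℕ) :
    sd α p (xS α δ) (n + 1 + k) - sd α p (xS α δ) (n + 1) = TT α p δ n k := by
  unfold sd TT
  rw [Finset.sum_range_add, add_sub_cancel_left]
  refine Finset.sum_congr rfl fun i _ => ?_
  have := xS_dev hα hp δ (n + i)
  rw [← this, show n + 1 + i = n + i + 1 by ring]

lemma avg_TT {α p : ℝ} (δ : ℕ → ℝ) {N : ℕ} (hN : 1 ≤ N) (n : ℕ) :
    avgD δ N n = 1 / (p * α) + TT α p δ n N / N := by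
  have : (N : ℝ) ≠ 0 := by positivity
  unfold avgD TT
  rw [Finset.sum_sub_distrib, Finset.sum_const, Finset.card_range, nsmul_eq_mul]
  field_simp
  ring

lemma TT_add (α p : ℝ) (δ : ℕ → ℝ) (n k l : ℕ) :
    TT α p δ n (k + l) = TT α p δ n k + TT α p δ (n + k) l := by
  unfold TT
  rw [Finset.sum_range_add]
  simp only [add_assoc]

lemma TT_bound {α p c M : ℝ} {δ : ℕ → ℝ} {N : ℕ} (hN : 1 ≤ N) (hc : 0 ≤ c)
    (hM : ∀ n, |δ n - 1 / (p * α)| ≤ M) (h : ∀ n, |TT α p δ n N| ≤ c * N) :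
    ∀ k n, |TT α p δ n k| ≤ c * k + N * M := by
  have hM0 : 0 ≤ M := (abs_nonneg _).trans (hM 0)
  intro k
  induction k using Nat.strong_induction_on with
  | _ k ih =>
    intro n
    rcases lt_or_ge k N with hk | hk
    · have h1 : |TT α p δ n k| ≤ k * M := by
        unfold TT
        refine (Finset.abs_sum_le_sum_abs _ _).trans ?_
        refine (Finset.sum_le_sum fun i _ => hM (n + i)).trans ?_
        simp
      have h2 : (k : ℝ) * M ≤ N * M := by gcongr
      have h3 : 0 ≤ c * k := by positivity
      linarith
    · obtain ⟨l, rfl⟩ := Nat.exists_eq_add_of_le hk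
      rw [TT_add]
      refine (abs_add_le _ _).trans ?_
      have := ih l (by omega) (n + N)
      have := h n
      push_cast
      linarith

lemma suff_side {α p : ℝ} (hα : 0 < α) (hp : 1 < p)
    {γ : ℕ → ℂ} (hinj : Function.Injective γ)
    (hmono : ∀ n, ‖γ n‖ ≤ ‖γ (n + 1)‖) {δ : ℕ → ℝ}
    (hn : ∀ n : ℕ, ‖γ n‖ = Real.exp ((1 + (n : ℝ)) / (2 * α) + δ n))
    (hsep : DRhoSeparated α (Set.range γ)) {M : ℝ} (hM : ∀ n, |δ n| ≤ M) {N : ℕ} (hN : 1 ≤ N)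
    (h1 : 1 / (p * α) - 1 / (4 * α) < (⨅ n : ℕ, avgD δ N n))
    (h2 : (⨆ n : ℕ, avgD δ N n) < 1 / (p * α) + 1 / (4 * α)) :
    ∃ g : ℂ, g ∉ Set.range γ ∧ ‖g‖ ≤ ‖γ 0‖ ∧
      CompleteInterpolating α p (insert g (Set.range γ)) := by
  have hp0 : 0 < p := by linarith
  have hm : Monotone fun n => ‖γ n‖ := monotone_nat_of_le_succ hmono
  have hpos : ∀ n, 0 < ‖γ n‖ := fun n => by rw [hn]; positivity
  have hghalf : ‖γ 0 / 2‖ = ‖γ 0‖ / 2 := by simp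
  have hg : γ 0 / 2 ∉ Set.range γ := by
    rintro ⟨n, h⟩
    have h3 : ‖γ 0‖ ≤ ‖γ n‖ := hm (Nat.zero_le n)
    rw [h, hghalf] at h3
    linarith [hpos 0]
  have hg0 : ‖γ 0 / 2‖ ≤ ‖γ 0‖ := by rw [hghalf]; linarith [hpos 0]
  refine ⟨γ 0 / 2, hg, hg0, ?_⟩
  have S := pseqS hinj hmono hn hg hg0
  rw [← range_muS]
  set c0 := 1 / (p * α) with hc0
  have hc0p : 0 < c0 := by positivity
  have hM2 : ∀ n, |δ n - c0| ≤ M + c0 := fun n => by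
    refine (abs_sub _ _).trans ?_
    rw [abs_of_pos hc0p]; linarith [hM n]
  have hM0 : 0 ≤ M + c0 := (abs_nonneg _).trans (hM2 0)
  have hNr : (0 : ℝ) < N := by positivity
  have hTb : ∀ n, |TT α p δ n N / N| ≤ M + c0 := by
    intro n
    rw [abs_div, abs_of_pos hNr, div_le_iff₀ hNr]
    unfold TT
    refine (Finset.abs_sum_le_sum_abs _ _).trans ?_
    refine (Finset.sum_le_sum fun i _ => hM2 (n + i)).trans ?_
    rw [Finset.sum_const, Finset.card_range, nsmul_eq_mul, mul_comm]
  have hbb : BddBelow (Set.range fun n : ℕ => avgD δ N n) := by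
    refine ⟨c0 - (M + c0), ?_⟩
    rintro _ ⟨n, rfl⟩
    have := avg_TT (α := α) (p := p) δ hN n
    have h3 := (abs_le.1 (hTb n)).1
    simp only [this]; linarith
  have hba : BddAbove (Set.range fun n : ℕ => avgD δ N n) := by
    refine ⟨c0 + (M + c0), ?_⟩
    rintro _ ⟨n, rfl⟩
    have := avg_TT (α := α) (p := p) δ hN n
    have h3 := (abs_le.1 (hTb n)).2
    simp only [this]; linarith
  set ε := min ((⨅ n : ℕ, avgD δ N n) - (c0 - 1 / (4 * α)))
    (c0 + 1 / (4 * α) - (⨆ n : ℕ, avgD δ N n)) with hε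
  have hε0 : 0 < ε := lt_min (by linarith) (by linarith)
  have hT : ∀ n, |TT α p δ n N| ≤ (1 / (4 * α) - ε) * N := by
    intro n
    have e := avg_TT (α := α) (p := p) δ hN n
    have a1 := ciInf_le hbb n
    have a2 := le_ciSup hba n
    have b1 := min_le_left ((⨅ n : ℕ, avgD δ N n) - (c0 - 1 / (4 * α)))
      (c0 + 1 / (4 * α) - (⨆ n : ℕ, avgD δ N n))
    have b2 := min_le_right ((⨅ n : ℕ, avgD δ N n) - (c0 - 1 / (4 * α)))
      (c0 + 1 / (4 * α) - (⨆ n : ℕ, avgD δ N n))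
    beta_reduce at a1 a2
    rw [e] at a1 a2
    have : |TT α p δ n N / N| ≤ 1 / (4 * α) - ε := by
      rw [abs_le]; constructor <;> linarith
    rwa [abs_div, abs_of_pos hNr, div_le_iff₀ hNr] at this
  have hc : 0 ≤ 1 / (4 * α) - ε := by
    have := (abs_nonneg _).trans (hT 0)
    exact nonneg_of_mul_nonneg_left this hNr
  have hTT := TT_bound hN hc hM2 hT
  set d0 := |xS α δ 0 - (((0 : ℕ) : ℝ) + 2 / p) / (2 * α)| with hd0
  have hd00 : 0 ≤ d0 := abs_nonneg _
  refine suff S hα hp hε0 (M := max d0 (M + c0)) (K := d0 + N * (M + c0)) ?_ ?_ ?_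
  · intro j
    cases j with
    | zero => exact le_max_left _ _
    | succ j =>
      rw [xS_dev hα hp0]
      exact (hM2 j).trans (le_max_right _ _)
  · obtain ⟨η, hη, hs⟩ := hsep
    have hsq : 0 < Real.sqrt (2 * α) := Real.sqrt_pos.2 (by positivity)
    refine ⟨min (1 / 2) (η / (2 * Real.sqrt (2 * α))), by positivity, fun i j hij => ?_⟩
    obtain ⟨j, rfl⟩ : ∃ n, j = n + 1 := ⟨j - 1, by omega⟩
    have ej : Real.exp (xS α δ (j + 1)) = ‖γ j‖ := (hn j).symm
    rw [ej]
    have half : ∀ w : ℂ, ‖w‖ ≤ ‖γ j‖ / 2 →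
        min (1 / 2) (η / (2 * Real.sqrt (2 * α))) * ‖γ j‖ ≤ ‖γ j - w‖ := by
      intro w hw
      have h3 := norm_sub_norm_le (γ j) w
      have h4 : min (1 / 2) (η / (2 * Real.sqrt (2 * α))) * ‖γ j‖ ≤ 1 / 2 * ‖γ j‖ := by
        gcongr; exact min_le_left _ _
      linarith
    cases i with
    | zero =>
      apply half
      show ‖γ 0 / 2‖ ≤ _
      rw [hghalf]
      have : ‖γ 0‖ ≤ ‖γ j‖ := hm (Nat.zero_le j)
      linarith
    | succ i =>
      rcases le_or_gt ‖γ i‖ (‖γ j‖ / 2) with hle | hgt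
      · exact half _ hle
      · have hne : γ j ≠ γ i := fun e => by have := hinj e; omega
        have h3 := hs (γ j) ⟨j, rfl⟩ (γ i) ⟨i, rfl⟩ hne
        have hij2 : ‖γ i‖ ≤ ‖γ j‖ := hm (by omega)
        unfold dRho rhoF at h3
        rw [min_eq_right (by gcongr), le_div_iff₀ (by positivity)] at h3
        show _ ≤ ‖γ j - γ i‖
        refine le_trans ?_ h3
        calc _ ≤ η / (2 * Real.sqrt (2 * α)) * ‖γ j‖ := by gcongr; exact min_le_right _ _
          _ = η * ((‖γ j‖ / 2) / Real.sqrt (2 * α)) := by field_simp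
          _ ≤ η * (‖γ i‖ / Real.sqrt (2 * α)) := by gcongr
          _ ≤ _ := by gcongr; linarith
  · intro m n hmn
    have hNM : 0 ≤ N * (M + c0) := by positivity
    cases m with
    | succ m =>
      obtain ⟨k, rfl⟩ := Nat.exists_eq_add_of_le hmn
      rw [sd_TT hα hp0]
      have := hTT k m
      push_cast
      have e : (m : ℝ) + 1 + k - (m + 1) = k := by ring
      rw [e]; linarith
    | zero =>
      cases n with
      | zero => simp; linarith
      | succ n =>
        have e1 := sd_TT hα hp0 δ 0 n
        have e2 : sd α p (xS α δ) (0 + 1) = xS α δ 0 - (((0 : ℕ) : ℝ) + 2 / p) / (2 * α) := by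
          simp [sd]
        have e3 : sd α p (xS α δ) 0 = 0 := by simp [sd]
        have e4 : sd α p (xS α δ) (n + 1) = TT α p δ 0 n +
            (xS α δ 0 - (((0 : ℕ) : ℝ) + 2 / p) / (2 * α)) := by
          rw [← e1, ← e2, show 0 + 1 + n = n + 1 by ring]; ring
        rw [e3, e4, sub_zero]
        refine (abs_add_le _ _).trans ?_
        have := hTT n 0
        push_cast
        have e5 : (1 / (4 * α) - ε) * (n + 1 - 0) = (1 / (4 * α) - ε) * n + (1 / (4 * α) - ε) := by
          ring
        rw [e5]; linarith

lemma nec_side {α p : ℝ} (hα : 0 < α) (hp : 1 < p)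
    {γ : ℕ → ℂ} (hinj : Function.Injective γ)
    (hmono : ∀ n, ‖γ n‖ ≤ ‖γ (n + 1)‖) {δ : ℕ → ℝ}
    (hn : ∀ n : ℕ, ‖γ n‖ = Real.exp ((1 + (n : ℝ)) / (2 * α) + δ n))
    {g : ℂ} (hg : g ∉ Set.range γ) (hg0 : ‖g‖ ≤ ‖γ 0‖)
    (h : CompleteInterpolating α p (insert g (Set.range γ))) :
    DRhoSeparated α (Set.range γ) ∧
       (∃ M : ℝ, ∀ n, |δ n| ≤ M) ∧
       (∃ N : ℕ, 1 ≤ N ∧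
         1 / (p * α) - 1 / (4 * α) < (⨅ n : ℕ, avgD δ N n) ∧
         (⨆ n : ℕ, avgD δ N n) < 1 / (p * α) + 1 / (4 * α)) := by
  have hp0 : 0 < p := by linarith
  have hm : Monotone fun n => ‖γ n‖ := monotone_nat_of_le_succ hmono
  have hpos : ∀ n, 0 < ‖γ n‖ := fun n => by rw [hn]; positivity
  have S := pseqS hinj hmono hn hg hg0
  rw [← range_muS] at h
  obtain ⟨⟨ε, hε, hs⟩, ⟨M, hM⟩, ⟨η, K, hη, hK⟩⟩ := cis_nec S hα hp h
  refine ⟨?_, ?_, ?_⟩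
  · have hsq : 0 < Real.sqrt (2 * α) := Real.sqrt_pos.2 (by positivity)
    have h0 := hpos 0
    set L := 1 / ‖γ 0‖ + 1 / Real.sqrt (2 * α) with hL
    have hL0 : 0 < L := by positivity
    have key : ∀ i j, i < j → ε / L ≤ dRho α (γ j) (γ i) := by
      intro i j hij
      have h1 : ε * Real.exp (xS α δ (j + 1)) ≤ ‖γ j - γ i‖ := hs (i + 1) (j + 1) (by omega)
      have ej : Real.exp (xS α δ (j + 1)) = ‖γ j‖ := (hn j).symm
      rw [ej] at h1
      have hj := hpos j
      have hj0 : ‖γ 0‖ ≤ ‖γ j‖ := hm (Nat.zero_le j)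
      unfold dRho
      have hr : 1 + min (rhoF α (γ j)) (rhoF α (γ i)) ≤ ‖γ j‖ * L := by
        have a1 : min (rhoF α (γ j)) (rhoF α (γ i)) ≤ ‖γ j‖ / Real.sqrt (2 * α) := min_le_left _ _
        have a2 : 1 ≤ ‖γ j‖ / ‖γ 0‖ := (one_le_div h0).2 hj0
        have a3 : ‖γ j‖ * L = ‖γ j‖ / ‖γ 0‖ + ‖γ j‖ / Real.sqrt (2 * α) := by rw [hL]; ring
        linarith
      have hr0 : 0 < 1 + min (rhoF α (γ j)) (rhoF α (γ i)) := by
        unfold rhoF; positivity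
      rw [div_le_div_iff₀ hL0 hr0]
      calc _ ≤ ε * (‖γ j‖ * L) := by gcongr
        _ = ε * ‖γ j‖ * L := by ring
        _ ≤ _ := by gcongr
    refine ⟨ε / L, by positivity, ?_⟩
    rintro _ ⟨i, rfl⟩ _ ⟨j, rfl⟩ hne
    have hij : i ≠ j := fun e => hne (by rw [e])
    rcases lt_or_gt_of_ne hij with hlt | hlt
    · have := key i j hlt
      unfold dRho at this ⊢
      rwa [norm_sub_rev, min_comm]
    · exact key j i hlt
  · refine ⟨M + 1 / (p * α), fun n => ?_⟩
    have h1 := hM (n + 1)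
    rw [xS_dev hα hp0] at h1
    have hc : 0 < 1 / (p * α) := by positivity
    rw [abs_le] at h1 ⊢
    constructor <;> linarith [h1.1, h1.2]
  · obtain ⟨N, hNK⟩ := exists_nat_gt (2 * |K| / η)
    have hNK1 : 2 * |K| / η < ((N + 1 : ℕ) : ℝ) := by push_cast; linarith
    refine ⟨N + 1, by omega, ?_⟩
    have hNr : (0 : ℝ) < ((N + 1 : ℕ) : ℝ) := by positivity
    have hT : ∀ n, |TT α p δ n (N + 1) / ((N + 1 : ℕ) : ℝ)| ≤ 1 / (4 * α) - η / 2 := by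
      intro n
      rw [abs_div, abs_of_pos hNr, div_le_iff₀ hNr]
      have h1 := hK (n + 1) (n + 1 + (N + 1)) (by omega)
      rw [sd_TT hα hp0] at h1
      have e : ((n + 1 + (N + 1) : ℕ) : ℝ) - ((n + 1 : ℕ) : ℝ) = ((N + 1 : ℕ) : ℝ) := by
        push_cast; ring
      rw [e] at h1
      rw [div_lt_iff₀ hη] at hNK1
      have := le_abs_self K
      nlinarith
    constructor
    · have : 1 / (p * α) - 1 / (4 * α) + η / 2 ≤ ⨅ n : ℕ, avgD δ (N + 1) n := by
        refine le_ciInf fun n => ?_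
        rw [avg_TT (α := α) (p := p) δ (by omega) n]
        linarith [(abs_le.1 (hT n)).1]
      linarith
    · have : ⨆ n : ℕ, avgD δ (N + 1) n ≤ 1 / (p * α) + 1 / (4 * α) - η / 2 := by
        refine ciSup_le fun n => ?_
        rw [avg_TT (α := α) (p := p) δ (by omega) n]
        linarith [(abs_le.1 (hT n)).2]
      linarith

/-- for `4 < p < ∞`, there exists a point `γ₋₁ ∈ ℂ ∖ Γ` with `|γ₋₁| ≤ |γ₀|`
such that `Γ ∪ {γ₋₁}` is a complete interpolating sequence for `F^p_φ`
iff `Γ` is `d_ρ`-separated, `(δ_n)` is bounded, and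
`1/(pα) - 1/(4α) < ∇_N ≤ Δ_N < 1/(pα) + 1/(4α)` for some `N ≥ 1`. -/
theorem statement2 (α p : ℝ) (hα : 0 < α) (hp : 4 < p)
    (γ : ℕ → ℂ) (hinj : Function.Injective γ)
    (hmono : ∀ n, ‖γ n‖ ≤ ‖γ (n + 1)‖)
    (δ θ : ℕ → ℝ)
    (hdecomp : ∀ n, γ n =
      (Real.exp ((1 + (n : ℝ)) / (2 * α) + δ n) : ℂ) * Complex.exp ((θ n : ℂ) * Complex.I)) :
    (∃ g : ℂ, g ∉ Set.range γ ∧ ‖g‖ ≤ ‖γ 0‖ ∧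
      CompleteInterpolating α p (insert g (Set.range γ))) ↔
      (DRhoSeparated α (Set.range γ) ∧
       (∃ M : ℝ, ∀ n, |δ n| ≤ M) ∧
       (∃ N : ℕ, 1 ≤ N ∧
         1 / (p * α) - 1 / (4 * α) < (⨅ n : ℕ, avgD δ N n) ∧
         (⨆ n : ℕ, avgD δ N n) < 1 / (p * α) + 1 / (4 * α))) := by
  have hn : ∀ n : ℕ, ‖γ n‖ = Real.exp ((1 + (n : ℝ)) / (2 * α) + δ n) := by
    intro n
    rw [hdecomp n, norm_mul, Complex.norm_exp_ofReal_mul_I, mul_one, Complex.norm_real,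
      Real.norm_of_nonneg (Real.exp_pos _).le]
  constructor
  · rintro ⟨g, hg, hg0, h⟩
    exact nec_side hα (by linarith) hinj hmono hn hg hg0 h
  · rintro ⟨hs, ⟨M, hM⟩, N, hN, h1, h2⟩
    exact suff_side hα (by linarith) hinj hmono hn hs hM hN h1 h2

end
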